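/- Let Γ be a finite simple graph on m ≥ 1 vertices and N ≥ 2 an integer. Then the unreduced suspension of the space Conf_Γ(ℝ^N) ⊔ {∗} (a disjoint basepoint added) is homotopy equivalent to a wedge of spheres containing, for each 1 ≤ i ≤ m, exactly a_i spheres of dimension (m−i)(N−1)+1, and no other spheres. -/

import Mathlib

/-!
STATEMENT 2: For a finite simple graph Γ on m ≥ 1 vertices and N ≥ 2, the
unreduced suspension of Conf_Γ(ℝ^N) with a disjoint basepoint added is homotopy
equivalent to a wedge of spheres containing, for each 1 ≤ i ≤ m, exactly a_i
spheres of dimension (m−i)(N−1)+1 (and no others), where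
a_i = (−1)^{m−i}·(coefficient of λ^i in the chromatic polynomial of Γ).
-/

/-- The chromatic configuration space `Conf_Γ(ℝ^N)`. -/
abbrev chromConf (N m : ℕ) (G : SimpleGraph (Fin m)) : Type :=
  {x : Fin m → EuclideanSpace ℝ (Fin N) // ∀ i j, G.Adj i j → x i ≠ x j}

/-- The sphere of dimension `n` (the unit sphere in `ℝ^{n+1}`). -/
abbrev sph (n : ℕ) : Type := Metric.sphere (0 : EuclideanSpace ℝ (Fin (n + 1))) 1

/-- A basepoint on the `n`-sphere. -/
noncomputable def sphBase (n : ℕ) : sph n :=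
  ⟨EuclideanSpace.single 0 1, by simp⟩

/-- The unreduced suspension of a space: the quotient of `Y × [0,1]` collapsing
`Y × {0}` to one point and `Y × {1}` to another. -/
abbrev Susp (Y : Type) [TopologicalSpace Y] : Type :=
  Quot (fun a b : Y × unitInterval =>
    (a.2 = 0 ∧ b.2 = 0) ∨ (a.2 = 1 ∧ b.2 = 1))

/-- The wedge of a family of spheres of dimensions `dims j`, `j : ι`: the quotient
of the disjoint union identifying all the basepoints. -/
abbrev WedgeSpheres (ι : Type) (dims : ι → ℕ) : Type :=
  Quot (fun x y : (Σ j : ι, sph (dims j)) =>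
    x.2 = sphBase (dims x.1) ∧ y.2 = sphBase (dims y.1))

open scoped unitInterval Topology

/-- A pointed topological space. -/
structure Pt where
  T : Type
  [top : TopologicalSpace T]
  pt : T

attribute [instance] Pt.top

/-- A pointed map. -/
@[ext]
structure PHom (A B : Pt) where
  f : C(A.T, B.T)
  map_pt : f A.pt = B.pt

namespace Pt

/-- The fundamental group of a pointed space. -/
abbrev pi (A : Pt) := FundamentalGroup A.T A.pt

/-- The class of a loop. -/
def cls {A : Pt} (p : Path A.pt A.pt) : A.pi :=
  FundamentalGroup.fromPath (Path.Homotopic.Quotient.mk p)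

theorem cls_surj {A : Pt} (z : A.pi) : ∃ p, cls p = z :=
  Path.Homotopic.Quotient.mk_surjective z

theorem cls_eq {A : Pt} {p q : Path A.pt A.pt} : cls p = cls q ↔ p.Homotopic q :=
  Path.Homotopic.Quotient.eq

theorem cls_mul {A : Pt} (p q : Path A.pt A.pt) : cls p * cls q = cls (q.trans p) := rfl

theorem cls_refl {A : Pt} : cls (Path.refl A.pt) = 1 := rfl

end Pt

open Pt

namespace PHom

variable {A B C : Pt}

/-- Composition of pointed maps. -/
def comp (g : PHom B C) (f : PHom A B) : PHom A C :=
  ⟨g.f.comp f.f, by simp [f.map_pt, g.map_pt]⟩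

/-- The image of a loop. -/
def mapPath (f : PHom A B) (p : Path A.pt A.pt) : Path B.pt B.pt :=
  (p.map f.f.continuous).cast f.map_pt.symm f.map_pt.symm

@[simp] theorem mapPath_apply (f : PHom A B) (p : Path A.pt A.pt) (t : I) :
    f.mapPath p t = f.f (p t) := rfl

/-- The induced homomorphism on fundamental groups. -/
noncomputable def pi (f : PHom A B) : A.pi →* B.pi :=
  FundamentalGroup.mapOfEq f.f f.map_pt

theorem pi_cls (f : PHom A B) (p : Path A.pt A.pt) : f.pi (cls p) = cls (f.mapPath p) := by
  rw [pi, FundamentalGroup.mapOfEq_apply]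
  rfl

theorem pi_comp (g : PHom B C) (f : PHom A B) (z : A.pi) : g.pi (f.pi z) = (g.comp f).pi z := by
  obtain ⟨p, rfl⟩ := cls_surj z
  simp only [pi_cls]
  rfl

theorem pi_id (f : PHom A A) (h : ∀ x, f.f x = x) (z : A.pi) : f.pi z = z := by
  obtain ⟨p, rfl⟩ := cls_surj z
  rw [pi_cls]
  congr 1
  ext t
  simp [h]

theorem pi_const (f : PHom A B) (h : ∀ x, f.f x = B.pt) (z : A.pi) : f.pi z = 1 := by
  obtain ⟨p, rfl⟩ := cls_surj z
  rw [pi_cls, ← cls_refl]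
  congr 1
  ext t
  simp [h]

/-- Pointed homotopy. -/
def Htpy (f g : PHom A B) : Prop :=
  ∃ H : C(I × A.T, B.T), (∀ x, H (0, x) = f.f x) ∧ (∀ x, H (1, x) = g.f x) ∧ ∀ t, H (t, A.pt) = B.pt

theorem Htpy.pi_eq {f g : PHom A B} (h : f.Htpy g) (z : A.pi) : f.pi z = g.pi z := by
  obtain ⟨p, rfl⟩ := cls_surj z
  obtain ⟨H, h0, h1, hb⟩ := h
  rw [pi_cls, pi_cls, cls_eq]
  refine ⟨⟨⟨⟨fun x => H (x.1, p x.2), by fun_prop⟩, ?_, ?_⟩, ?_⟩⟩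
  · intro x; simp [h0]
  · intro x; simp [h1]
  · rintro t x (rfl | hx)
    · simp [hb]
    · rw [Set.mem_singleton_iff] at hx
      subst hx
      simp [hb]

end PHom

namespace Pt

variable {A B : Pt}

theorem cls_eq_iff {p q : Path A.pt A.pt} : cls p = cls q ↔
    ∃ H : C(I × I, A.T), (∀ t, H (0, t) = p t) ∧ (∀ t, H (1, t) = q t) ∧
      (∀ s, H (s, 0) = A.pt) ∧ ∀ s, H (s, 1) = A.pt := by
  rw [cls_eq]
  constructor
  · rintro ⟨H⟩
    exact ⟨H.toContinuousMap, fun t => H.apply_zero t, fun t => H.apply_one t,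
      fun s => Path.Homotopy.source H s, fun s => Path.Homotopy.target H s⟩
  · rintro ⟨H, h0, h1, h2, h3⟩
    refine ⟨⟨⟨H, h0, h1⟩, ?_⟩⟩
    rintro t x (rfl | hx)
    · simp [h2]
    · rw [Set.mem_singleton_iff] at hx
      subst hx
      simp [h3]

theorem cls_eq_of {p q : Path A.pt A.pt} (H : I → I → A.T) (hc : Continuous fun x : I × I => H x.1 x.2)
    (h0 : ∀ t, H 0 t = p t) (h1 : ∀ t, H 1 t = q t) (h2 : ∀ s, H s 0 = A.pt)
    (h3 : ∀ s, H s 1 = A.pt) : cls p = cls q :=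
  cls_eq_iff.2 ⟨⟨_, hc⟩, h0, h1, h2, h3⟩

/-- The homotopy fibre of a pointed map. -/
def Hfib (p : PHom A B) : Pt :=
  ⟨{x : A.T × C(I, B.T) // x.2 0 = p.f x.1 ∧ x.2 1 = B.pt},
    ⟨(A.pt, ContinuousMap.const _ B.pt), by simp [p.map_pt]⟩⟩

/-- The projection from the homotopy fibre. -/
def Hfib.fst (p : PHom A B) : PHom (Hfib p) A :=
  ⟨⟨fun x => x.1.1, continuous_fst.comp continuous_subtype_val⟩, rfl⟩

theorem Hfib.ext' {p : PHom A B} {x y : (Hfib p).T} (h : x.1.1 = y.1.1)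
    (h' : ∀ u, x.1.2 u = y.1.2 u) : x = y :=
  Subtype.ext (Prod.ext h (ContinuousMap.ext h'))

theorem Hfib.continuous_mk {p : PHom A B} {X : Type} [TopologicalSpace X] {F : X → (Hfib p).T}
    (h1 : Continuous fun x => (F x).1.1) (h2 : Continuous fun x : X × I => (F x.1).1.2 x.2) :
    Continuous F :=
  continuous_induced_rng.2 (h1.prodMk (ContinuousMap.continuous_of_continuous_uncurry _ h2))

theorem Hfib.continuous_snd {p : PHom A B} : Continuous fun x : (Hfib p).T × I => x.1.1.2 x.2 := by
  have : Continuous fun x : (Hfib p).T => x.1.2 := Continuous.snd continuous_subtype_val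
  fun_prop

theorem Hfib.fst_surj (p : PHom A B) (z : A.pi) (hz : p.pi z = 1) :
    ∃ y : (Hfib p).pi, (Hfib.fst p).pi y = z := by
  obtain ⟨l, rfl⟩ := cls_surj z
  rw [PHom.pi_cls, ← cls_refl, cls_eq_iff] at hz
  obtain ⟨H, h0, h1, h2, h3⟩ := hz
  let F : I → (Hfib p).T := fun t => ⟨(l t, ⟨fun u => H (u, t), by fun_prop⟩), by
    simp [h0, h1]⟩
  have hF : Continuous F := Hfib.continuous_mk (by simp only [F]; fun_prop)
    (by simp only [F, ContinuousMap.coe_mk]; fun_prop)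
  refine ⟨cls ⟨⟨F, hF⟩, Hfib.ext' (by simp [F]; rfl) (by simp [F, h2]; intros; rfl),
    Hfib.ext' (by simp [F]; rfl) (by simp [F, h3]; intros; rfl)⟩, ?_⟩
  rw [PHom.pi_cls]
  rfl

/-- The projection of a real number to the unit interval. -/
noncomputable abbrev cl (x : ℝ) : I := Set.projIcc 0 1 zero_le_one x

theorem continuous_cl : Continuous cl := continuous_projIcc

theorem cl_coe (x : I) : cl x = x := Set.projIcc_val _ x

theorem cl_of_le {x : ℝ} (h : x ≤ 0) : cl x = 0 := Set.projIcc_of_le_left _ h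

theorem cl_of_ge {x : ℝ} (h : 1 ≤ x) : cl x = 1 := Set.projIcc_of_right_le _ h

theorem Hfib.fst_inj (p : PHom A B) (s : PHom B A) (hs : ∀ b, p.f (s.f b) = b) :
    Function.Injective (Hfib.fst p).pi := by
  rw [injective_iff_map_eq_one]
  intro y hy
  obtain ⟨l, rfl⟩ := cls_surj y
  rw [PHom.pi_cls, ← cls_refl, cls_eq_iff] at hy
  obtain ⟨n, n0, n1, n2, n3⟩ := hy
  rw [← cls_refl]
  let G : ℝ → I → B.T := fun v t => if v ≤ 0 then p.f (n (cl (-v), t)) else (l t).1.2 (cl v)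
  have hl : Continuous fun x : I × I => (l x.1).1.2 x.2 :=
    Hfib.continuous_snd.comp (f := fun x : I × I => (l x.1, x.2)) (by fun_prop)
  have hG : Continuous fun x : ℝ × I => G x.1 x.2 := by
    refine Continuous.if_le (f' := fun x : ℝ × I => p.f (n (cl (-x.1), x.2)))
      (g' := fun x : ℝ × I => (l x.2).1.2 (cl x.1)) ?_ ?_ continuous_fst continuous_const ?_
    · have := continuous_cl
      fun_prop
    · exact hl.comp (f := fun x : ℝ × I => (x.2, cl x.1))
        (by have := continuous_cl; fun_prop)
    · rintro ⟨v, t⟩ h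
      dsimp only at h ⊢
      subst h
      rw [neg_zero, cl_of_le le_rfl, n0, (l t).2.1]
      rfl
  have hG' : ∀ {X : Type} [TopologicalSpace X] (a : X → ℝ) (b : X → I), Continuous a → Continuous b →
      Continuous fun x => G (a x) (b x) := fun a b ha hb => hG.comp (ha.prodMk hb)
  have G1 : ∀ v t, 1 ≤ v → G v t = B.pt := by
    intro v t hv
    simp only [G]
    rw [if_neg (by linarith), cl_of_ge hv, (l t).2.2]
  have Gm1 : ∀ t, G (-1) t = B.pt := by
    intro t
    simp only [G]
    rw [if_pos (by norm_num), neg_neg, cl_of_ge le_rfl, n1]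
    exact p.map_pt
  have Gneg : ∀ (τ : I) t, G (-τ) t = p.f (n (τ, t)) := by
    intro τ t
    simp only [G]
    rw [if_pos (by have := τ.2.1; linarith), neg_neg, cl_coe]
  have Gpos : ∀ (τ : I) t, G τ t = (l t).1.2 τ := by
    intro τ t
    rcases eq_or_lt_of_le τ.2.1 with h | h
    · have := Gneg 0 t
      obtain rfl : τ = 0 := Subtype.ext h.symm
      simp only [Set.Icc.coe_zero, neg_zero] at this ⊢
      rw [this, n0, (l t).2.1]
      rfl
    · simp only [G]
      rw [if_neg (by linarith), cl_coe]
  have Gend : ∀ v t, (t = 0 ∨ t = 1) → G v t = B.pt := by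
    intro v t ht
    have h1 : n (cl (-v), t) = A.pt := by rcases ht with rfl | rfl <;> simp [n2, n3]
    have h2 : (l t).1.2 (cl v) = B.pt := by
      rcases ht with rfl | rfl
      · rw [l.source]; rfl
      · rw [l.target]; rfl
    simp only [G]
    rw [h1, h2, p.map_pt, ite_self]
  have nend : ∀ v t, (t = 0 ∨ t = 1) → n (v, t) = A.pt := by
    rintro v t (rfl | rfl) <;> simp [n2, n3]
  let H1 : I → I → (Hfib p).T := fun τ t =>
    ⟨(n (τ, t), ⟨fun u => G (-τ + u * (1 + τ)) t, hG' _ _ (by fun_prop) (by fun_prop)⟩), by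
      constructor
      · simp [Gneg]
      · simp only [ContinuousMap.coe_mk]
        exact G1 _ _ (by simp)⟩
  have H1c : Continuous fun x : I × I => H1 x.1 x.2 :=
    Hfib.continuous_mk (by simp only [H1]; fun_prop)
      (hG' (fun x : (I × I) × I => (-x.1.1 + x.2 * (1 + x.1.1) : ℝ)) (fun x => x.1.2)
        (by fun_prop) (by fun_prop))
  have H1e : ∀ τ t, (t = 0 ∨ t = 1) → H1 τ t = (Hfib p).pt := fun τ t ht =>
    Hfib.ext' (nend _ _ ht) fun u => Gend _ _ ht
  let H2 : I → I → (Hfib p).T := fun w t =>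
    ⟨(s.f (G (2 * w - 1) t), ⟨fun u => G ((2 * w - 1) + u * (1 - (2 * w - 1))) t,
      hG' _ _ (by fun_prop) (by fun_prop)⟩), by
      constructor
      · simp [hs]
      · simp only [ContinuousMap.coe_mk]
        exact G1 _ _ (by simp)⟩
  have H2c : Continuous fun x : I × I => H2 x.1 x.2 :=
    Hfib.continuous_mk (s.f.continuous.comp
        (hG' (fun x : I × I => (2 * x.1 - 1 : ℝ)) (fun x => x.2) (by fun_prop) (by fun_prop)))
      (hG' (fun x : (I × I) × I => ((2 * x.1.1 - 1) + x.2 * (1 - (2 * x.1.1 - 1)) : ℝ))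
        (fun x => x.1.2) (by fun_prop) (by fun_prop))
  have H2e : ∀ τ t, (t = 0 ∨ t = 1) → H2 τ t = (Hfib p).pt := fun τ t ht =>
    Hfib.ext' ((congrArg s.f (Gend _ _ ht)).trans s.map_pt) fun u => Gend _ _ ht
  let q : Path (Hfib p).pt (Hfib p).pt :=
    ⟨⟨fun t => H1 1 t, H1c.comp (f := fun t : I => ((1 : I), t)) (by fun_prop)⟩,
      H1e _ _ (Or.inl rfl), H1e _ _ (Or.inr rfl)⟩
  have e1 : cls l = cls q := by
    refine cls_eq_of H1 H1c (fun t => ?_) (fun t => rfl) (fun τ => H1e _ _ (Or.inl rfl))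
      (fun τ => H1e _ _ (Or.inr rfl))
    refine Hfib.ext' (n0 t) fun u => ?_
    simp only [H1, ContinuousMap.coe_mk]
    rw [← Gpos]
    simp
  have e2 : cls q = cls (Path.refl (Hfib p).pt) := by
    refine cls_eq_of H2 H2c (fun t => ?_) (fun t => ?_) (fun τ => H2e _ _ (Or.inl rfl))
      (fun τ => H2e _ _ (Or.inr rfl))
    · refine Hfib.ext' ?_ fun u => ?_
      · change s.f (G (2 * ((0 : I) : ℝ) - 1) t) = n (1, t)
        rw [n1]
        simp only [Set.Icc.coe_zero, mul_zero, zero_sub, Gm1, s.map_pt]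
        rfl
      · change G _ t = G _ t
        congr 1
        simp
    · refine Hfib.ext' ?_ fun u => ?_
      · change s.f (G _ t) = A.pt
        rw [G1 _ _ (by norm_num), s.map_pt]
      · exact G1 _ _ (by norm_num)
  rw [e1, e2]

end Pt

/-- The pointed space of all maps from `X`. -/
def MapSp (X : Type) [TopologicalSpace X] (W : Pt) : Pt := ⟨C(X, W.T), ContinuousMap.const _ W.pt⟩

/-- The pointed space of pointed maps from a sphere. -/
def Lam (n : ℕ) (W : Pt) : Pt :=
  ⟨{f : C(sph n, W.T) // f (sphBase n) = W.pt}, ⟨ContinuousMap.const _ W.pt, rfl⟩⟩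

section

variable {X Y Z : Type} [TopologicalSpace X] [TopologicalSpace Y] [TopologicalSpace Z]
  {W W' W'' : Pt} {n : ℕ}

theorem MapSp.continuous_mk {F : Z → (MapSp X W).T}
    (h : Continuous fun x : Z × X => (show C(X, W.T) from F x.1) x.2) : Continuous F :=
  ContinuousMap.continuous_of_continuous_uncurry _ h

theorem Lam.continuous_mk {F : Z → (Lam n W).T}
    (h : Continuous fun x : Z × sph n => (F x.1).1 x.2) : Continuous F :=
  continuous_induced_rng.2 (ContinuousMap.continuous_of_continuous_uncurry _ h)

theorem MapSp.continuous_ev [LocallyCompactSpace X] {F : Z → C(X, W.T)} {g : Z → X}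
    (hF : Continuous (Y := (MapSp X W).T) F) (hg : Continuous g) :
    Continuous fun z => (F z) (g z) := by
  have : Continuous F := hF
  fun_prop

theorem Lam.continuous_ev {F : Z → (Lam n W).T} {g : Z → sph n} (hF : Continuous F)
    (hg : Continuous g) : Continuous fun z => (F z).1 (g z) := by
  have : Continuous fun z => (F z).1 := continuous_subtype_val.comp hF
  fun_prop

theorem MapSp.ext' {f g : (MapSp X W).T}
    (h : ∀ x, (show C(X, W.T) from f) x = (show C(X, W.T) from g) x) : f = g :=
  ContinuousMap.ext h

theorem Lam.ext' {f g : (Lam n W).T} (h : ∀ x, f.1 x = g.1 x) : f = g :=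
  Subtype.ext (ContinuousMap.ext h)

/-- Precomposition. -/
def pre (W : Pt) (h : C(X, Y)) : PHom (MapSp Y W) (MapSp X W) :=
  ⟨⟨fun f => ContinuousMap.comp f h, ContinuousMap.continuous_precomp h⟩, rfl⟩

/-- Postcomposition. -/
def post (X : Type) [TopologicalSpace X] (φ : PHom W W') : PHom (MapSp X W) (MapSp X W') :=
  ⟨⟨fun f => ContinuousMap.comp φ.f f, ContinuousMap.continuous_postcomp φ.f⟩,
    MapSp.ext' fun _ => φ.map_pt⟩

/-- Constant maps. -/
def cst (X : Type) [TopologicalSpace X] (W : Pt) : PHom W (MapSp X W) :=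
  ⟨⟨fun w => ContinuousMap.const X w, MapSp.continuous_mk (by
    change Continuous fun x : W.T × X => x.1
    fun_prop)⟩, rfl⟩

/-- Evaluation along a direction map. -/
def eta [LocallyCompactSpace X] (W : Pt) (d : C(X, sph n)) :
    PHom (MapSp X (Lam n W)) (MapSp X W) :=
  ⟨⟨fun f => ⟨fun x => (show (Lam n W).T from (show C(X, (Lam n W).T) from f) x).1 (d x),
      Lam.continuous_ev (ContinuousMap.continuous _) d.continuous⟩,
    MapSp.continuous_mk (Lam.continuous_ev
      (F := fun p : (MapSp X (Lam n W)).T × X => (show C(X, (Lam n W).T) from p.1) p.2)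
      (MapSp.continuous_ev continuous_fst continuous_snd) (by fun_prop))⟩, rfl⟩

/-- Functoriality of `Lam`. -/
def Lam.map (n : ℕ) (φ : PHom W W') : PHom (Lam n W) (Lam n W') :=
  ⟨⟨fun f => ⟨φ.f.comp f.1, by simp [f.2, φ.map_pt]⟩, Lam.continuous_mk
    (φ.f.continuous.comp (Lam.continuous_ev continuous_fst continuous_snd))⟩,
    Lam.ext' fun _ => φ.map_pt⟩

theorem pre_htpy [LocallyCompactSpace Y] {h h' : C(X, Y)} (H : h.Homotopic h')
    (z : (MapSp Y W).pi) : (pre W h).pi z = (pre W h').pi z := by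
  obtain ⟨H⟩ := H
  refine PHom.Htpy.pi_eq ⟨⟨fun p => (show C(X, W.T) from
    ⟨fun x => (show C(Y, W.T) from p.2) (H (p.1, x)),
      (ContinuousMap.continuous _).comp (by fun_prop)⟩), ?_⟩, ?_, ?_, ?_⟩ z
  · exact MapSp.continuous_mk (MapSp.continuous_ev (W := W)
      (F := fun p : (I × (MapSp Y W).T) × X => (show C(Y, W.T) from p.1.2))
      (g := fun p => H (p.1.1, p.2)) (continuous_snd.comp continuous_fst) (by fun_prop))
  · exact fun f => MapSp.ext' fun x => congrArg (show C(Y, W.T) from f) (H.apply_zero x)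
  · exact fun f => MapSp.ext' fun x => congrArg (show C(Y, W.T) from f) (H.apply_one x)
  · exact fun t => rfl

theorem eta_htpy [LocallyCompactSpace X] {d d' : C(X, sph n)} (H : d.Homotopic d')
    (z : (MapSp X (Lam n W)).pi) : (eta W d).pi z = (eta W d').pi z := by
  obtain ⟨H⟩ := H
  refine PHom.Htpy.pi_eq ⟨⟨fun p => (show C(X, W.T) from
    ⟨fun x => (show (Lam n W).T from (show C(X, (Lam n W).T) from p.2) x).1 (H (p.1, x)),
      Lam.continuous_ev (ContinuousMap.continuous _) (by fun_prop)⟩), ?_⟩, ?_, ?_, ?_⟩ z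
  · exact MapSp.continuous_mk (Lam.continuous_ev
      (F := fun p : (I × (MapSp X (Lam n W)).T) × X => (show C(X, (Lam n W).T) from p.1.2) p.2)
      (MapSp.continuous_ev (by fun_prop) (by fun_prop)) (by fun_prop))
  · exact fun f => MapSp.ext' fun x => congrArg
      (show (Lam n W).T from (show C(X, (Lam n W).T) from f) x).1 (H.apply_zero x)
  · exact fun f => MapSp.ext' fun x => congrArg
      (show (Lam n W).T from (show C(X, (Lam n W).T) from f) x).1 (H.apply_one x)
  · exact fun t => rfl

theorem pre_pre (h : C(X, Y)) (h' : C(Y, Z)) (z : (MapSp Z W).pi) :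
    (pre W h).pi ((pre W h').pi z) = (pre W (h'.comp h)).pi z :=
  PHom.pi_comp _ _ _

theorem pre_id (z : (MapSp X W).pi) : (pre W (ContinuousMap.id X)).pi z = z :=
  PHom.pi_id _ (fun _ => rfl) z

theorem post_post (ψ : PHom W' W'') (φ : PHom W W') (z : (MapSp X W).pi) :
    (post X ψ).pi ((post X φ).pi z) = (post X (ψ.comp φ)).pi z :=
  PHom.pi_comp _ _ _

theorem pre_eta [LocallyCompactSpace X] [LocallyCompactSpace Y] (h : C(X, Y)) (d : C(Y, sph n))
    (z : (MapSp Y (Lam n W)).pi) :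
    (pre W h).pi ((eta W d).pi z) = (eta W (d.comp h)).pi ((pre _ h).pi z) := by
  rw [PHom.pi_comp, PHom.pi_comp]
  rfl

theorem post_eta [LocallyCompactSpace X] (φ : PHom W W') (d : C(X, sph n))
    (z : (MapSp X (Lam n W)).pi) :
    (post X φ).pi ((eta W d).pi z) = (eta W' d).pi ((post X (Lam.map n φ)).pi z) := by
  rw [PHom.pi_comp, PHom.pi_comp]
  rfl

theorem pre_cst (h : C(X, Y)) (z : W.pi) : (pre W h).pi ((cst Y W).pi z) = (cst X W).pi z :=
  PHom.pi_comp _ _ _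

theorem post_cst (φ : PHom W W') (z : W.pi) :
    (post X φ).pi ((cst X W).pi z) = (cst X W').pi (φ.pi z) := by
  rw [PHom.pi_comp, PHom.pi_comp]
  rfl

/-- Functions into a product with a sphere: evaluation along the sphere coordinate. -/
noncomputable def kap (W : Pt) (Y : Type) [TopologicalSpace Y] [LocallyCompactSpace Y] (n : ℕ) :
    (MapSp Y (Lam n W)).pi →* (MapSp (Y × sph n) W).pi :=
  (eta W (ContinuousMap.snd : C(Y × sph n, sph n))).pi.comp (pre _ ContinuousMap.fst).pi

/-- The inclusion of a space in its product with a sphere. -/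
noncomputable def incPt (Y : Type) [TopologicalSpace Y] (n : ℕ) : C(Y, Y × sph n) :=
  ⟨fun y => (y, sphBase n), by fun_prop⟩

end

section Collapse

variable {n : ℕ}

theorem sphBase_zero (n : ℕ) : (sphBase n).1 0 = 1 := by simp [sphBase]

/-- The vector whose normalization is the collapsing homotopy. -/
noncomputable def collapseVec (n : ℕ) (τ : ℝ) (θ : sph n) : EuclideanSpace ℝ (Fin (n + 1)) :=
  (1 - τ * (1 - max 0 (min 1 (1 - 2 * θ.1 0)))) • (θ.1 - θ.1 0 • (sphBase n).1) +
    θ.1 0 • (sphBase n).1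

theorem collapseVec_ne_zero (τ : ℝ) (θ : sph n) : collapseVec n τ θ ≠ 0 := by
  intro h
  have h0 : θ.1 0 = 0 := by
    have := congrArg (fun v : EuclideanSpace ℝ (Fin (n + 1)) => v 0) h
    simpa [collapseVec, sphBase_zero] using this
  rw [collapseVec, h0] at h
  simp only [mul_zero, sub_zero, zero_smul, add_zero, min_self, zero_le_one, sup_of_le_right,
    sub_self, one_smul] at h
  have := θ.2
  rw [mem_sphere_zero_iff_norm, h] at this
  simp at this

/-- The homotopy from the identity to a map collapsing a cap to the base point. -/
noncomputable def collapse (n : ℕ) : C(ℝ × sph n, sph n) where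
  toFun x := ⟨‖collapseVec n x.1 x.2‖⁻¹ • collapseVec n x.1 x.2, by
    rw [mem_sphere_zero_iff_norm, norm_smul, norm_inv, norm_norm,
      inv_mul_cancel₀ (norm_ne_zero_iff.2 (collapseVec_ne_zero _ _))]⟩
  continuous_toFun := by
    have h : Continuous fun x : ℝ × sph n => collapseVec n x.1 x.2 := by
      unfold collapseVec
      fun_prop
    exact ((h.norm.inv₀ fun x => norm_ne_zero_iff.2 (collapseVec_ne_zero _ _)).smul h).subtype_mk _

theorem collapse_base (τ : ℝ) : collapse n (τ, sphBase n) = sphBase n := by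
  apply Subtype.ext
  have : collapseVec n τ (sphBase n) = (sphBase n).1 := by simp [collapseVec, sphBase_zero]
  change ‖collapseVec n τ (sphBase n)‖⁻¹ • collapseVec n τ (sphBase n) = _
  rw [this, mem_sphere_zero_iff_norm.1 (sphBase n).2]
  simp

theorem collapse_zero (θ : sph n) : collapse n (0, θ) = θ := by
  apply Subtype.ext
  have : collapseVec n 0 θ = θ.1 := by simp [collapseVec]
  change ‖collapseVec n 0 θ‖⁻¹ • collapseVec n 0 θ = _
  rw [this, mem_sphere_zero_iff_norm.1 θ.2]
  simp

theorem collapse_one (θ : sph n) (h : 1 / 2 ≤ θ.1 0) : collapse n (1, θ) = sphBase n := by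
  apply Subtype.ext
  have : collapseVec n 1 θ = θ.1 0 • (sphBase n).1 := by
    rw [collapseVec, min_eq_right (by linarith), max_eq_left (by linarith)]
    simp
  change ‖collapseVec n 1 θ‖⁻¹ • collapseVec n 1 θ = _
  have h0 : 0 < θ.1 0 := by linarith
  rw [this, norm_smul, mem_sphere_zero_iff_norm.1 (sphBase n).2, mul_one, Real.norm_of_nonneg h0.le,
    smul_smul, inv_mul_cancel₀ h0.ne', one_smul]

end Collapse

section K

variable {Y : Type} [TopologicalSpace Y] {W : Pt} {n : ℕ}

/-- The underlying pointed map of `kap`. -/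
noncomputable def kapHom (W : Pt) (Y : Type) [TopologicalSpace Y] [LocallyCompactSpace Y] (n : ℕ) :
    PHom (MapSp Y (Lam n W)) (MapSp (Y × sph n) W) :=
  (eta W (ContinuousMap.snd : C(Y × sph n, sph n))).comp (pre _ ContinuousMap.fst)

theorem kap_eq [LocallyCompactSpace Y] (z : (MapSp Y (Lam n W)).pi) :
    kap W Y n z = (kapHom W Y n).pi z := by
  rw [kapHom, ← PHom.pi_comp]
  rfl

/-- Functions on the product as functions with values on the sphere, given a null-homotopy over
the base point. -/
noncomputable def fibFun (τ : ℝ) (x : (Hfib (pre W (incPt Y n))).T) (y : Y) (θ : sph n) : W.T :=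
  if θ.1 0 ≤ 1 / 2 then (show C(Y × sph n, W.T) from x.1.1) (y, collapse n (1, θ))
  else (show C(Y, W.T) from x.1.2 (cl (τ * (2 * θ.1 0 - 1)))) y

theorem continuous_fibFun [LocallyCompactSpace Y] {Z : Type} [TopologicalSpace Z] {τ : Z → ℝ}
    {x : Z → (Hfib (pre W (incPt Y n))).T} {y : Z → Y} {θ : Z → sph n} (hτ : Continuous τ)
    (hx : Continuous x) (hy : Continuous y) (hθ : Continuous θ) :
    Continuous fun z => fibFun (τ z) (x z) (y z) (θ z) := by
  refine Continuous.if_le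
    (f' := fun z => (show C(Y × sph n, W.T) from (x z).1.1) (y z, collapse n (1, θ z)))
    (g' := fun z => (show C(Y, W.T) from (x z).1.2 (cl (τ z * (2 * (θ z).1 0 - 1)))) (y z))
    ?_ ?_ ?_ continuous_const ?_
  · exact MapSp.continuous_ev (Continuous.fst (continuous_subtype_val.comp hx)) (by fun_prop)
  · refine MapSp.continuous_ev (W := W) (Hfib.continuous_snd.comp (f := fun z =>
      (x z, cl (τ z * (2 * (θ z).1 0 - 1)))) ?_) hy
    have := continuous_cl
    fun_prop
  · fun_prop
  · intro z hz
    rw [collapse_one _ hz.ge, hz, cl_of_le (by norm_num)]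
    exact (congrArg (fun f : C(Y, W.T) => f (y z)) (x z).2.1).symm

theorem fibFun_one_base (x : (Hfib (pre W (incPt Y n))).T) (y : Y) :
    fibFun 1 x y (sphBase n) = W.pt := by
  rw [fibFun, sphBase_zero, if_neg (by norm_num), cl_of_ge (by norm_num)]
  exact congrArg (fun f : C(Y, W.T) => f y) x.2.2

theorem fibFun_zero (x : (Hfib (pre W (incPt Y n))).T) (y : Y) (θ : sph n) :
    fibFun 0 x y θ = (show C(Y × sph n, W.T) from x.1.1) (y, collapse n (1, θ)) := by
  rw [fibFun]
  split_ifs with h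
  · rfl
  · rw [collapse_one _ (by linarith), cl_of_le (by norm_num)]
    exact congrArg (fun f : C(Y, W.T) => f y) x.2.1

theorem fibFun_pt (τ : ℝ) (y : Y) (θ : sph n) :
    fibFun τ (Hfib (pre W (incPt Y n))).pt y θ = W.pt := by
  rw [fibFun]
  split_ifs <;> rfl

variable [LocallyCompactSpace Y]

/-- The map from the homotopy fibre. -/
noncomputable def fibMap (W : Pt) (Y : Type) [TopologicalSpace Y] [LocallyCompactSpace Y] (n : ℕ) :
    PHom (Hfib (pre W (incPt Y n))) (MapSp Y (Lam n W)) :=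
  ⟨⟨fun x => (show C(Y, (Lam n W).T) from ⟨fun y => ⟨⟨fun θ => fibFun 1 x y θ,
      continuous_fibFun continuous_const continuous_const continuous_const continuous_id⟩,
      fibFun_one_base x y⟩, Lam.continuous_mk (continuous_fibFun continuous_const continuous_const
        continuous_fst continuous_snd)⟩),
    MapSp.continuous_mk (Lam.continuous_mk (continuous_fibFun continuous_const
      (by fun_prop) (by fun_prop) (by fun_prop)))⟩,
    MapSp.ext' fun y => Lam.ext' fun θ => fibFun_pt _ _ _⟩

/-- The lift to the homotopy fibre. -/
noncomputable def fibInc (W : Pt) (Y : Type) [TopologicalSpace Y] [LocallyCompactSpace Y] (n : ℕ) :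
    PHom (MapSp Y (Lam n W)) (Hfib (pre W (incPt Y n))) :=
  ⟨⟨fun f => ⟨((kapHom W Y n).f f, ContinuousMap.const _ (MapSp Y W).pt),
      (MapSp.ext' fun y => ((show C(Y, (Lam n W).T) from f) y).2.symm), rfl⟩,
    Hfib.continuous_mk (kapHom W Y n).f.continuous continuous_const⟩, rfl⟩

theorem kapHom_fibMap (z : (Hfib (pre W (incPt Y n))).pi) :
    (kapHom W Y n).pi ((fibMap W Y n).pi z) = (Hfib.fst _).pi z := by
  rw [PHom.pi_comp]
  let F : PHom (Hfib (pre W (incPt Y n))) (MapSp (Y × sph n) W) :=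
    ⟨⟨fun x => (show C(Y × sph n, W.T) from ⟨fun p => fibFun 0 x p.1 p.2,
      continuous_fibFun continuous_const continuous_const continuous_fst continuous_snd⟩),
    MapSp.continuous_mk (continuous_fibFun continuous_const
      (by fun_prop) (by fun_prop) (by fun_prop))⟩,
    MapSp.ext' fun y => fibFun_pt _ _ _⟩
  trans F.pi z
  · symm
    refine PHom.Htpy.pi_eq ⟨⟨fun q => (show C(Y × sph n, W.T) from
      ⟨fun p => fibFun q.1 q.2 p.1 p.2,
      continuous_fibFun continuous_const continuous_const continuous_fst continuous_snd⟩),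
      MapSp.continuous_mk (continuous_fibFun (by fun_prop)
      (by fun_prop) (by fun_prop) (by fun_prop))⟩, fun x => rfl, fun x => rfl,
      fun t => MapSp.ext' fun p => fibFun_pt _ _ _⟩ z
  · symm
    refine PHom.Htpy.pi_eq ⟨⟨fun q : I × (Hfib (pre W (incPt Y n))).T => (show C(Y × sph n, W.T) from
      ⟨fun p => (show C(Y × sph n, W.T) from q.2.1.1) (p.1, collapse n (q.1, p.2)),
      (ContinuousMap.continuous _).comp (by fun_prop)⟩),
      MapSp.continuous_mk (MapSp.continuous_ev (W := W)
        (F := fun p : (I × (Hfib (pre W (incPt Y n))).T) × Y × sph n =>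
          (show C(Y × sph n, W.T) from p.1.2.1.1)) (Continuous.fst
        (continuous_subtype_val.comp (continuous_snd.comp continuous_fst))) (by fun_prop))⟩,
      fun x => ?_, fun x => ?_,
      fun t => MapSp.ext' fun p => rfl⟩ z
    · refine MapSp.ext' fun p => ?_
      exact congrArg (fun θ => (show C(Y × sph n, W.T) from x.1.1) (p.1, θ)) (collapse_zero p.2)
    · exact MapSp.ext' fun p => (fibFun_zero x p.1 p.2).symm

theorem fibMap_fibInc (z : (MapSp Y (Lam n W)).pi) : (fibMap W Y n).pi ((fibInc W Y n).pi z) = z := by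
  rw [PHom.pi_comp]
  trans (⟨ContinuousMap.id _, rfl⟩ : PHom (MapSp Y (Lam n W)) (MapSp Y (Lam n W))).pi z
  swap
  · exact PHom.pi_id _ (fun _ => rfl) z
  symm
  refine PHom.Htpy.pi_eq ⟨⟨fun q : I × (MapSp Y (Lam n W)).T => (show C(Y, (Lam n W).T) from
      ⟨fun y => ⟨⟨fun θ => ((show C(Y, (Lam n W).T) from q.2) y).1 (collapse n (q.1, θ)),
        (ContinuousMap.continuous _).comp (by fun_prop)⟩, ?_⟩, ?_⟩), ?_⟩, fun f => ?_, fun f => ?_,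
      fun t => rfl⟩ z
  · exact (congrArg ((show C(Y, (Lam n W).T) from q.2) y).1 (collapse_base _)).trans
      ((show C(Y, (Lam n W).T) from q.2) y).2
  · exact Lam.continuous_mk (Lam.continuous_ev (F := fun p : Y × sph n =>
      (show C(Y, (Lam n W).T) from q.2) p.1) ((ContinuousMap.continuous _).comp continuous_fst)
      (by fun_prop))
  · exact MapSp.continuous_mk (Lam.continuous_mk (Lam.continuous_ev
      (F := fun p : ((I × (MapSp Y (Lam n W)).T) × Y) × sph n =>
        (show C(Y, (Lam n W).T) from p.1.1.2) p.1.2)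
      (MapSp.continuous_ev (by fun_prop) (by fun_prop)) (by fun_prop)))
  · exact MapSp.ext' fun y => Lam.ext' fun θ =>
      congrArg ((show C(Y, (Lam n W).T) from f) y).1 (collapse_zero θ)
  · refine MapSp.ext' fun y => Lam.ext' fun θ => ?_
    change ((show C(Y, (Lam n W).T) from f) y).1 (collapse n (1, θ)) = fibFun _ _ _ _
    rw [fibFun]
    split_ifs with h
    · rfl
    · rw [collapse_one _ (by linarith)]
      exact ((show C(Y, (Lam n W).T) from f) y).2

theorem kap_injective : Function.Injective (kap W Y n) := by
  intro z z' h
  rw [kap_eq, kap_eq] at h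
  have key : ∀ z, (kapHom W Y n).pi z = (Hfib.fst _).pi ((fibInc W Y n).pi z) := by
    intro z
    rw [PHom.pi_comp]
    rfl
  rw [key, key] at h
  have := Hfib.fst_inj (pre W (incPt Y n)) (pre W ContinuousMap.fst) (fun f => rfl) h
  rw [← fibMap_fibInc z, this, fibMap_fibInc]

theorem pre_incPt_kap (z : (MapSp Y (Lam n W)).pi) : (pre W (incPt Y n)).pi (kap W Y n z) = 1 := by
  rw [kap_eq, PHom.pi_comp]
  exact PHom.pi_const _ (fun f => MapSp.ext' fun y => ((show C(Y, (Lam n W).T) from f) y).2) z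

theorem exists_kap (z : (MapSp (Y × sph n) W).pi) (hz : (pre W (incPt Y n)).pi z = 1) :
    ∃ y, kap W Y n y = z := by
  obtain ⟨y, hy⟩ := Hfib.fst_surj _ z hz
  exact ⟨(fibMap W Y n).pi y, by rw [kap_eq, kapHom_fibMap, hy]⟩

end K

/-- Iterates of `Lam`. -/
def LamN (n : ℕ) : ℕ → Pt → Pt
  | 0, W => W
  | k + 1, W => LamN n k (Lam n W)

/-- Functoriality of `LamN`. -/
def LamN.map (n : ℕ) : ∀ (k : ℕ) {W W' : Pt}, PHom W W' → PHom (LamN n k W) (LamN n k W')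
  | 0, _, _, φ => φ
  | k + 1, _, _, φ => LamN.map n k (Lam.map n φ)

/-- Deletion-contraction trees. -/
inductive Tr (D : Type)
  | leaf : Tr D
  | zero : Tr D
  | node : D → Tr D → Tr D → Tr D

namespace Tr

variable {D : Type}

/-- The leaves of a tree. -/
def ix : Tr D → Type
  | leaf => Unit
  | zero => Empty
  | node _ l r => l.ix ⊕ r.ix

/-- The number of contractions leading to a leaf. -/
def ht : (t : Tr D) → t.ix → ℕ
  | leaf, _ => 0
  | zero, a => nomatch (show Empty from a)
  | node _ l r, a => Sum.elim (fun a => l.ht a + 1) (fun a => r.ht a) (show l.ix ⊕ r.ix from a)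

/-- All labels of a tree satisfy a predicate. -/
def All (p : D → Prop) : Tr D → Prop
  | leaf => True
  | zero => True
  | node e l r => p e ∧ l.All p ∧ r.All p

theorem All.mono {p q : D → Prop} (h : ∀ e, p e → q e) : ∀ {t : Tr D}, t.All p → t.All q
  | leaf, _ => trivial
  | zero, _ => trivial
  | node _ _ _, ⟨h1, h2, h3⟩ => ⟨h _ h1, h2.mono h, h3.mono h⟩

/-- Coefficients attached to the leaves of a tree. -/
abbrev Co (n : ℕ) (t : Tr D) (W : Pt) := ∀ a : t.ix, (LamN n (t.ht a) W).pi

/-- The restriction of coefficients to the left subtree. -/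
def Co.left {n : ℕ} {e : D} {l r : Tr D} {W : Pt} (b : Co n (node e l r) W) : Co n l (Lam n W) :=
  fun a => b (show (node e l r).ix from Sum.inl a)

/-- The restriction of coefficients to the right subtree. -/
def Co.right {n : ℕ} {e : D} {l r : Tr D} {W : Pt} (b : Co n (node e l r) W) : Co n r W :=
  fun a => b (show (node e l r).ix from Sum.inr a)

/-- Coefficients on both subtrees. -/
def Co.mk {n : ℕ} {e : D} {l r : Tr D} {W : Pt} (b : Co n l (Lam n W)) (c : Co n r W) :
    Co n (node e l r) W
  | Sum.inl a => b a
  | Sum.inr a => c a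

theorem Co.ext_node {n : ℕ} {e : D} {l r : Tr D} {W : Pt} {b c : Co n (node e l r) W}
    (hl : b.left = c.left) (hr : b.right = c.right) : b = c := by
  funext a
  rcases a with a | a
  · exact congrFun hl a
  · exact congrFun hr a

/-- The action of a pointed map on coefficients. -/
noncomputable def Co.map {n : ℕ} {t : Tr D} {W W' : Pt} (φ : PHom W W') (b : Co n t W) :
    Co n t W' :=
  fun a => (LamN.map n (t.ht a) φ).pi (b a)

end Tr

open Tr

section Phi

variable {D : Type} {n : ℕ}
variable {X Y : Type} [TopologicalSpace X] [TopologicalSpace Y] [LocallyCompactSpace X]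
  [LocallyCompactSpace Y]

/-- The map from coefficients on a tree to homotopy classes of maps determined by
direction maps. -/
noncomputable def Phi (X : Type) [TopologicalSpace X] [LocallyCompactSpace X]
    (d : D → C(X, sph n)) : ∀ (t : Tr D) (W : Pt), Co n t W → (MapSp X W).pi
  | leaf, W, b => (cst X W).pi (b ())
  | zero, _, _ => 1
  | node e l r, W, b => (eta W (d e)).pi (Phi X d l (Lam n W) b.left) * Phi X d r W b.right

theorem pre_Phi (h : C(X, Y)) (d : D → C(Y, sph n)) : ∀ (t : Tr D) (W : Pt) (b : Co n t W),
    (pre W h).pi (Phi Y d t W b) = Phi X (fun e => (d e).comp h) t W b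
  | leaf, W, b => pre_cst h _
  | zero, _, _ => map_one _
  | node e l r, W, b => by
    rw [Phi, Phi, map_mul, pre_eta, pre_Phi h d l, pre_Phi h d r]

theorem post_Phi (d : D → C(X, sph n)) : ∀ (t : Tr D) {W W' : Pt} (φ : PHom W W') (b : Co n t W),
    (post X φ).pi (Phi X d t W b) = Phi X d t W' (b.map φ)
  | leaf, W, W', φ, b => post_cst φ _
  | zero, _, _, _, _ => map_one _
  | node e l r, W, W', φ, b => by
    rw [Phi, Phi, map_mul, post_eta, post_Phi d l, post_Phi d r]
    rfl

theorem Phi_htpy (d d' : D → C(X, sph n)) : ∀ (t : Tr D) (W : Pt) (b : Co n t W),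
    t.All (fun e => (d e).Homotopic (d' e)) → Phi X d t W b = Phi X d' t W b
  | leaf, _, _, _ => rfl
  | zero, _, _, _ => rfl
  | node e l r, W, b, h => by
    rw [Phi, Phi, Phi_htpy d d' l _ _ h.2.1, Phi_htpy d d' r _ _ h.2.2, eta_htpy h.1]

end Phi

section Normalize

variable {n : ℕ}

open Classical in
/-- Normalization of vectors. -/
noncomputable def nrm (v : EuclideanSpace ℝ (Fin (n + 1))) : sph n :=
  if h : v = 0 then sphBase n else ⟨‖v‖⁻¹ • v, by
    rw [mem_sphere_zero_iff_norm, norm_smul, norm_inv, norm_norm,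
      inv_mul_cancel₀ (norm_ne_zero_iff.2 h)]⟩

theorem continuous_nrm {X : Type} [TopologicalSpace X] {f : X → EuclideanSpace ℝ (Fin (n + 1))}
    (hf : Continuous f) (h : ∀ x, f x ≠ 0) : Continuous fun x => nrm (f x) := by
  refine continuous_induced_rng.2 ?_
  have : (Subtype.val ∘ fun x => nrm (f x)) = fun x => ‖f x‖⁻¹ • f x := by
    funext x
    simp [nrm, h x]
  rw [this]
  exact (hf.norm.inv₀ fun x => norm_ne_zero_iff.2 (h x)).smul hf

theorem nrm_smul {a : ℝ} (ha : 0 < a) (θ : sph n) : nrm (a • θ.1) = θ := by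
  have h1 : ‖θ.1‖ = 1 := mem_sphere_zero_iff_norm.1 θ.2
  have h0 : a • θ.1 ≠ 0 := smul_ne_zero ha.ne' (norm_ne_zero_iff.1 (by rw [h1]; norm_num))
  apply Subtype.ext
  rw [nrm, dif_neg h0]
  simp [norm_smul, h1, abs_of_pos ha, smul_smul, ha.ne']

theorem norm_smul_nrm (v : EuclideanSpace ℝ (Fin (n + 1))) : ‖v‖ • (nrm v).1 = v := by
  by_cases h : v = 0
  · simp [h]
  · simp [nrm, h, smul_smul]

end Normalize

/-- The ambient space of configurations. -/
abbrev Amb (m n : ℕ) := Fin m → EuclideanSpace ℝ (Fin (n + 1))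

/-- Configurations in which the points joined by the relabelled edges are distinct. -/
abbrev MS {m : ℕ} (n : ℕ) (E : List (Fin m × Fin m)) (τ : Fin m → Fin m) : Type :=
  {x : Amb m n // ∀ e ∈ E, x (τ e.1) ≠ x (τ e.2)}

section Geometry

variable {m n : ℕ} {E : List (Fin m × Fin m)} {τ : Fin m → Fin m} {i j : Fin m}

theorem isOpen_MS (E : List (Fin m × Fin m)) (τ : Fin m → Fin m) :
    IsOpen {x : Amb m n | ∀ e ∈ E, x (τ e.1) ≠ x (τ e.2)} := by
  have : {x : Amb m n | ∀ e ∈ E, x (τ e.1) ≠ x (τ e.2)} =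
      ⋂ e ∈ {e | e ∈ E}, {x : Amb m n | x (τ e.1) ≠ x (τ e.2)} := by
    ext x; simp
  rw [this]
  exact (List.finite_toSet E).isOpen_biInter fun e _ =>
    isOpen_ne_fun (by fun_prop) (by fun_prop)

instance : LocallyCompactSpace (MS n E τ) := (isOpen_MS E τ).locallyCompactSpace

open Classical in
/-- The direction maps of a configuration space. -/
noncomputable def dirM (n : ℕ) (E : List (Fin m × Fin m)) (τ : Fin m → Fin m) (e : Fin m × Fin m) :
    C(MS n E τ, sph n) :=
  if h : e ∈ E then ⟨fun x => nrm (x.1 (τ e.2) - x.1 (τ e.1)),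
    continuous_nrm (((continuous_apply _).comp continuous_subtype_val).sub
      ((continuous_apply _).comp continuous_subtype_val)) fun x => sub_ne_zero.2 (x.2 e h).symm⟩
  else ContinuousMap.const _ (sphBase n)

theorem dirM_apply {e : Fin m × Fin m} (h : e ∈ E) (x : MS n E τ) :
    dirM n E τ e x = nrm (x.1 (τ e.2) - x.1 (τ e.1)) := by
  rw [dirM, dif_pos h]
  rfl

/-- The map identifying `j` with `i`. -/
def sg (i j : Fin m) : Fin m → Fin m := Function.update id j i

theorem sg_ne (hij : i ≠ j) (a : Fin m) : sg i j a ≠ j := by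
  unfold sg
  by_cases h : a = j
  · subst h; simp [hij]
  · simp [h]

/-- Placing the `j`-th point at a given displacement from the `i`-th one. -/
def pv (i j : Fin m) (x : Amb m n) (v : EuclideanSpace ℝ (Fin (n + 1))) : Amb m n :=
  Function.update x j (x i + v)

theorem continuous_pv {X : Type} [TopologicalSpace X] {f : X → Amb m n}
    {g : X → EuclideanSpace ℝ (Fin (n + 1))} (hf : Continuous f) (hg : Continuous g) :
    Continuous fun x => pv i j (f x) (g x) :=
  hf.update j (((continuous_apply i).comp hf).add hg)

theorem pv_j (x : Amb m n) (v) : pv i j x v j = x i + v := by simp [pv]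

theorem pv_ne (x : Amb m n) (v) {a : Fin m} (h : a ≠ j) : pv i j x v a = x a := by simp [pv, h]

theorem pv_self (x : Amb m n) : pv i j x (x j - x i) = x := by simp [pv]

theorem pv_zero (x : Amb m n) (a : Fin m) : pv i j x 0 a = x (sg i j a) := by
  by_cases h : a = j
  · subst h; simp [pv, sg]
  · simp [pv, sg, h]

theorem norm_pv_sub_le (x : Amb m n) (v) (a : Fin m) : ‖pv i j x v a - x (sg i j a)‖ ≤ ‖v‖ := by
  by_cases h : a = j
  · subst h; simp [pv, sg]
  · simp [pv, sg, h]

/-- A third of the minimal distance between points joined by edges. -/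
noncomputable def eps : List (Fin m × Fin m) → (Fin m → Fin m) → Amb m n → ℝ
  | [], _, _ => 1
  | e :: E, τ, x => min (‖x (τ e.1) - x (τ e.2)‖ / 3) (eps E τ x)

@[fun_prop]
theorem continuous_eps (E : List (Fin m × Fin m)) (τ : Fin m → Fin m) :
    Continuous fun x : Amb m n => eps E τ x := by
  induction E with
  | nil => exact continuous_const
  | cons e E ih => unfold eps; fun_prop

theorem eps_pos (E : List (Fin m × Fin m)) (τ : Fin m → Fin m) (x : Amb m n) :
    0 < eps E τ x ↔ ∀ e ∈ E, x (τ e.1) ≠ x (τ e.2) := by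
  induction E with
  | nil => simp [eps]
  | cons e E ih => simp [eps, ih, sub_eq_zero]

theorem eps_nonneg (E : List (Fin m × Fin m)) (τ : Fin m → Fin m) (x : Amb m n) :
    0 ≤ eps E τ x := by
  induction E with
  | nil => simp [eps]
  | cons e E ih => simp only [eps]; positivity

theorem eps_le (E : List (Fin m × Fin m)) (τ : Fin m → Fin m) (x : Amb m n) :
    ∀ e ∈ E, 3 * eps E τ x ≤ ‖x (τ e.1) - x (τ e.2)‖ := by
  induction E with
  | nil => simp
  | cons e E ih =>
    intro e' he'
    rcases List.mem_cons.1 he' with rfl | h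
    · have := min_le_left (‖x (τ e'.1) - x (τ e'.2)‖ / 3) (eps E τ x)
      simp only [eps]; linarith
    · have := min_le_right (‖x (τ e.1) - x (τ e.2)‖ / 3) (eps E τ x)
      have := ih e' h
      simp only [eps]; linarith

theorem eps_congr (E : List (Fin m × Fin m)) (τ : Fin m → Fin m) {x y : Amb m n}
    (h : ∀ a, x (τ a) = y (τ a)) : eps E τ x = eps E τ y := by
  induction E with
  | nil => rfl
  | cons e E ih => simp [eps, ih, h]

theorem eps_pv (hij : i ≠ j) (x : Amb m n) (v) :
    eps E (sg i j ∘ τ) (pv i j x v) = eps E (sg i j ∘ τ) x :=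
  eps_congr _ _ fun _ => pv_ne _ _ (sg_ne hij _)

theorem pv_mem {x : Amb m n} (hx : 0 < eps E (sg i j ∘ τ) x) {v}
    (hv : ‖v‖ ≤ eps E (sg i j ∘ τ) x) : ∀ e ∈ E, pv i j x v (τ e.1) ≠ pv i j x v (τ e.2) := by
  intro e he h
  have h1 := eps_le E (sg i j ∘ τ) x e he
  have h2 := norm_pv_sub_le (i := i) (j := j) x v (τ e.1)
  have h3 := norm_pv_sub_le (i := i) (j := j) x v (τ e.2)
  rw [h] at h2
  have h4 := norm_sub_le (pv i j x v (τ e.2) - x (sg i j (τ e.2)))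
    (pv i j x v (τ e.2) - x (sg i j (τ e.1)))
  rw [show (pv i j x v (τ e.2) - x (sg i j (τ e.2))) - (pv i j x v (τ e.2) - x (sg i j (τ e.1))) =
    x (sg i j (τ e.1)) - x (sg i j (τ e.2)) by abel] at h4
  simp only [Function.comp] at h1 h2 h3 h4 hx hv
  linarith

theorem eps_pos_of_lt {x : MS n E τ} (h : ‖x.1 j - x.1 i‖ < eps E (sg i j ∘ τ) x.1 ∨ x.1 j = x.1 i) :
    0 < eps E (sg i j ∘ τ) x.1 := by
  rcases h with h | h
  · exact (norm_nonneg _).trans_lt h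
  · rw [eps_pos]
    intro e he
    have := x.2 e he
    rw [← pv_self (i := i) (j := j) x.1, h, sub_self, pv_zero, pv_zero] at this
    exact this

end Geometry

section Step

variable {m n : ℕ} {E : List (Fin m × Fin m)} {τ : Fin m → Fin m} (e : Fin m × Fin m)

/-- The contracted relabelling. -/
abbrev ct (τ : Fin m → Fin m) (e : Fin m × Fin m) : Fin m → Fin m := sg (τ e.1) (τ e.2) ∘ τ

/-- The inclusion forgetting an edge. -/
def jj (n : ℕ) (E : List (Fin m × Fin m)) (τ : Fin m → Fin m) (e : Fin m × Fin m) :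
    C(MS n (e :: E) τ, MS n E τ) :=
  ⟨fun x => ⟨x.1, fun e' he' => x.2 e' (List.mem_cons_of_mem _ he')⟩, by fun_prop⟩

theorem mem_cons_iff {x : Amb m n} : (∀ e' ∈ e :: E, x (τ e'.1) ≠ x (τ e'.2)) ↔
    x (τ e.1) ≠ x (τ e.2) ∧ ∀ e' ∈ E, x (τ e'.1) ≠ x (τ e'.2) := by
  simp

/-- A short vector added to a contracted configuration. -/
noncomputable def radPt (n : ℕ) (E : List (Fin m × Fin m)) (τ : Fin m → Fin m) (e : Fin m × Fin m) :
    C(I × (MS n E (ct τ e) × sph n), MS n E τ) :=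
  ⟨fun p => ⟨pv (τ e.1) (τ e.2) p.2.1.1 ((p.1 * eps E (ct τ e) p.2.1.1 : ℝ) • p.2.2.1), by
    have h0 := (eps_pos E (ct τ e) p.2.1.1).2 p.2.1.2
    refine pv_mem h0 ?_
    rw [norm_smul, mem_sphere_zero_iff_norm.1 p.2.2.2, mul_one,
      Real.norm_of_nonneg (mul_nonneg p.1.2.1 h0.le)]
    exact mul_le_of_le_one_left h0.le p.1.2.2⟩, by
    have h : Continuous fun p : I × (MS n E (ct τ e) × sph n) => p.2.1.1 :=
      continuous_subtype_val.comp (continuous_fst.comp continuous_snd)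
    have h1 : Continuous fun p : I × (MS n E (ct τ e) × sph n) => p.2.2.1 :=
      continuous_subtype_val.comp (continuous_snd.comp continuous_snd)
    have h2 := (continuous_eps E (ct τ e)).comp h
    exact (continuous_pv h (((continuous_subtype_val.comp continuous_fst).mul h2).smul h1)).subtype_mk _⟩

/-- The map from the contracted configuration space. -/
def bb (n : ℕ) (E : List (Fin m × Fin m)) (τ : Fin m → Fin m) (e : Fin m × Fin m) :
    C(MS n E (ct τ e), MS n E τ) :=
  ⟨fun y => ⟨pv (τ e.1) (τ e.2) y.1 0, fun e' he' => by
    rw [pv_zero, pv_zero]; exact y.2 e' he'⟩, (continuous_pv (by fun_prop) (by fun_prop)).subtype_mk _⟩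

variable {e}

/-- The map splitting a point of a contracted configuration in two. -/
noncomputable def cc (n : ℕ) (E : List (Fin m × Fin m)) (τ : Fin m → Fin m) {e : Fin m × Fin m}
    (he : τ e.1 ≠ τ e.2) : C(MS n E (ct τ e) × sph n, MS n (e :: E) τ) :=
  ⟨fun p => ⟨(radPt n E τ e (1, p)).1, (mem_cons_iff e).2 ⟨by
    have h0 := (eps_pos E (ct τ e) p.1.1).2 p.1.2
    change pv _ _ _ _ _ ≠ pv _ _ _ _ _
    rw [pv_ne _ _ he, pv_j]
    have h1 : p.2.1 ≠ 0 := norm_ne_zero_iff.1 (by rw [mem_sphere_zero_iff_norm.1 p.2.2]; norm_num)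
    intro h
    exact (smul_ne_zero (by simpa using h0.ne') h1) (left_eq_add.1 h), (radPt n E τ e (1, p)).2⟩⟩,
    (continuous_subtype_val.comp ((radPt n E τ e).continuous.comp
      (continuous_const.prodMk continuous_id))).subtype_mk _⟩

theorem radPt_zero (p : MS n E (ct τ e) × sph n) : radPt n E τ e (0, p) = bb n E τ e p.1 := by
  apply Subtype.ext
  simp [radPt, bb]

theorem radPt_one (he : τ e.1 ≠ τ e.2) (p : MS n E (ct τ e) × sph n) :
    radPt n E τ e (1, p) = jj n E τ e (cc n E τ he p) := rfl

theorem dirM_cc (he : τ e.1 ≠ τ e.2) :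
    (dirM n (e :: E) τ e).comp (cc n E τ he) = ContinuousMap.snd := by
  ext1 p
  have h0 := (eps_pos E (ct τ e) p.1.1).2 p.1.2
  rw [ContinuousMap.comp_apply, dirM_apply (List.mem_cons_self)]
  change nrm (pv _ _ _ _ _ - pv _ _ _ _ _) = _
  rw [pv_ne _ _ he, pv_j, add_sub_cancel_left]
  exact nrm_smul (by simpa using h0) _

theorem dirM_jj {e' : Fin m × Fin m} (h : e' ∈ E) :
    (dirM n E τ e').comp (jj n E τ e) = dirM n (e :: E) τ e' := by
  ext1 p
  rw [ContinuousMap.comp_apply, dirM_apply h, dirM_apply (List.mem_cons_of_mem _ h)]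
  rfl

theorem dirM_cc_htpy (he : τ e.1 ≠ τ e.2) {e' : Fin m × Fin m} (h : e' ∈ E) :
    ((dirM n (e :: E) τ e').comp (cc n E τ he)).Homotopic
      ((dirM n E (ct τ e) e').comp ContinuousMap.fst) := by
  symm
  refine ⟨⟨(dirM n E τ e').comp (radPt n E τ e), fun p => ?_, fun p => ?_⟩⟩
  · change dirM n E τ e' (radPt n E τ e (0, p)) = dirM n E (ct τ e) e' p.1
    rw [radPt_zero, dirM_apply h, dirM_apply h]
    simp [bb, pv_zero]
  · rw [← dirM_jj h]
    rfl

end Step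

section Glue

variable {m n : ℕ} {E : List (Fin m × Fin m)} {τ : Fin m → Fin m} {e : Fin m × Fin m}

/-- The distance between the end points of an edge. -/
noncomputable def rad (τ : Fin m → Fin m) (e : Fin m × Fin m) (x : Amb m n) : ℝ :=
  ‖x (τ e.2) - x (τ e.1)‖

@[fun_prop]
theorem continuous_rad : Continuous fun x : Amb m n => rad τ e x := by
  unfold rad; fun_prop

theorem rad_nonneg (x : Amb m n) : 0 ≤ rad τ e x := norm_nonneg _

theorem rad_pv (he : τ e.1 ≠ τ e.2) (x : Amb m n) (v) :
    rad τ e (pv (τ e.1) (τ e.2) x v) = ‖v‖ := by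
  rw [rad, pv_ne _ _ he, pv_j, add_sub_cancel_left]

theorem rad_pos_of_le {x : MS n E τ} (h : eps E (ct τ e) x.1 ≤ 2 * rad τ e x.1) :
    0 < rad τ e x.1 := by
  by_contra h0
  have h1 : rad τ e x.1 = 0 := le_antisymm (not_lt.1 h0) (rad_nonneg _)
  have h2 : 0 < eps E (ct τ e) x.1 :=
    eps_pos_of_lt (Or.inr (sub_eq_zero.1 (norm_eq_zero.1 h1)))
  rw [h1] at h
  linarith

theorem mem_of_le {x : MS n E τ} (h : eps E (ct τ e) x.1 ≤ rad τ e x.1) :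
    ∀ e' ∈ e :: E, x.1 (τ e'.1) ≠ x.1 (τ e'.2) := by
  refine (mem_cons_iff e).2 ⟨?_, x.2⟩
  have := rad_pos_of_le (h.trans (by have := rad_nonneg (τ := τ) (e := e) x.1; linarith))
  exact (sub_ne_zero.1 (norm_pos_iff.1 this)).symm

theorem eps_pos_of_rad {x : MS n E τ} (h : ¬ eps E (ct τ e) x.1 ≤ rad τ e x.1) :
    0 < eps E (ct τ e) x.1 := (rad_nonneg _).trans_lt (not_le.1 h)

theorem eps_pos_of_rad' {x : MS n E τ} (h : 2 * rad τ e x.1 ≤ eps E (ct τ e) x.1) :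
    0 < eps E (ct τ e) x.1 := by
  by_contra h0
  have h1 := eps_nonneg E (ct τ e) x.1
  have h2 := rad_nonneg (τ := τ) (e := e) x.1
  have := rad_pos_of_le (x := x) (e := e) (by linarith)
  linarith

theorem eps_pos_of_rad'' {x : MS n E τ} (h : eps E (ct τ e) x.1 ≤ 2 * rad τ e x.1)
    (h' : rad τ e x.1 ≤ eps E (ct τ e) x.1) :
    0 < eps E (ct τ e) x.1 := (rad_pos_of_le h).trans_le h'

variable {Z : Type}

/-- The displacement direction of the end points of the edge. -/
noncomputable def dirE (τ : Fin m → Fin m) (e : Fin m × Fin m) (x : Amb m n) : sph n :=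
  nrm (x (τ e.2) - x (τ e.1))

theorem rad_smul_dirE (x : Amb m n) : rad τ e x • (dirE τ e x).1 = x (τ e.2) - x (τ e.1) :=
  norm_smul_nrm _

open Classical in
/-- Gluing a function on the complement of a hyperplane with a function on the hyperplane. -/
noncomputable def glue (F : MS n (e :: E) τ → Z) (f : MS n E (ct τ e) → Z)
    (K : I → MS n E (ct τ e) × sph n → Z) (x : MS n E τ) : Z :=
  if h1 : eps E (ct τ e) x.1 ≤ rad τ e x.1 then F ⟨x.1, mem_of_le h1⟩
  else if eps E (ct τ e) x.1 ≤ 2 * rad τ e x.1 then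
    K (cl (2 - 2 * rad τ e x.1 / eps E (ct τ e) x.1))
      (⟨x.1, (eps_pos _ _ _).1 (eps_pos_of_rad h1)⟩, dirE τ e x.1)
  else f ⟨x.1, (eps_pos _ _ _).1 (eps_pos_of_rad h1)⟩

variable {F : MS n (e :: E) τ → Z} {f : MS n E (ct τ e) → Z}
    {K : I → MS n E (ct τ e) × sph n → Z}

theorem glue_of_le {x : MS n E τ} (h : eps E (ct τ e) x.1 ≤ rad τ e x.1) :
    glue F f K x = F ⟨x.1, mem_of_le h⟩ := by
  rw [glue, dif_pos h]

theorem glue_mid (he : τ e.1 ≠ τ e.2) (h0 : ∀ p, K 0 p = F (cc n E τ he p)) {x : MS n E τ}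
    (h : eps E (ct τ e) x.1 ≤ 2 * rad τ e x.1) (h' : rad τ e x.1 ≤ eps E (ct τ e) x.1) :
    glue F f K x = K (cl (2 - 2 * rad τ e x.1 / eps E (ct τ e) x.1))
      (⟨x.1, (eps_pos _ _ _).1 (eps_pos_of_rad'' h h')⟩, dirE τ e x.1) := by
  by_cases h1 : eps E (ct τ e) x.1 ≤ rad τ e x.1
  · have hp := eps_pos_of_rad'' h h'
    have heq := le_antisymm h1 h'
    rw [glue_of_le h1, ← heq, mul_div_assoc, div_self hp.ne', cl_of_le (by norm_num), h0]
    congr 1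
    apply Subtype.ext
    change x.1 = pv _ _ x.1 ((((1 : I) : ℝ) * eps E (ct τ e) x.1) • (dirE τ e x.1).1)
    rw [Set.Icc.coe_one, one_mul, heq, rad_smul_dirE, pv_self]
  · rw [glue, dif_neg h1, if_pos h]

theorem glue_low (h1 : ∀ p, K 1 p = f p.1) {x : MS n E τ}
    (h : 2 * rad τ e x.1 ≤ eps E (ct τ e) x.1) :
    glue F f K x = f ⟨x.1, (eps_pos _ _ _).1 (eps_pos_of_rad' h)⟩ := by
  have hp := eps_pos_of_rad' h
  have h2 : ¬ eps E (ct τ e) x.1 ≤ rad τ e x.1 := by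
    have := rad_nonneg (τ := τ) (e := e) x.1
    intro h3
    linarith
  rw [glue, dif_neg h2]
  split_ifs with h3
  · have heq := le_antisymm h h3
    rw [heq, div_self hp.ne', cl_of_ge (by norm_num), h1]
  · rfl

theorem continuous_of_closed_cover {X Z : Type} [TopologicalSpace X] [TopologicalSpace Z]
    {f : X → Z} {s t u : Set X} (hs : IsClosed s) (ht : IsClosed t) (hu : IsClosed u)
    (h : ∀ x, x ∈ s ∨ x ∈ t ∨ x ∈ u) (h1 : Continuous (s.domRestrict f))
    (h2 : Continuous (t.domRestrict f)) (h3 : Continuous (u.domRestrict f)) : Continuous f := by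
  rw [← continuousOn_iff_continuous_domRestrict] at h1 h2 h3
  have := h1.union_of_isClosed (h2.union_of_isClosed h3 ht hu) hs (ht.union hu)
  rw [← continuousOn_univ]
  exact this.mono fun x _ => h x

theorem continuous_glue {T Z : Type} [TopologicalSpace T] [TopologicalSpace Z]
    (he : τ e.1 ≠ τ e.2)
    {F : T → MS n (e :: E) τ → Z} {f : T → MS n E (ct τ e) → Z}
    {K : T → I → MS n E (ct τ e) × sph n → Z}
    (hF : Continuous fun p : T × MS n (e :: E) τ => F p.1 p.2)
    (hf : Continuous fun p : T × MS n E (ct τ e) => f p.1 p.2)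
    (hK : Continuous fun p : T × (I × (MS n E (ct τ e) × sph n)) => K p.1 p.2.1 p.2.2)
    (h0 : ∀ t p, K t 0 p = F t (cc n E τ he p)) (h1 : ∀ t p, K t 1 p = f t p.1) :
    Continuous fun p : T × MS n E τ => glue (F p.1) (f p.1) (K p.1) p.2 := by
  have hv : Continuous fun p : T × MS n E τ => p.2.1 := by fun_prop
  have hr : Continuous fun p : T × MS n E τ => rad τ e p.2.1 := continuous_rad.comp hv
  have hE : Continuous fun p : T × MS n E τ => eps E (ct τ e) p.2.1 :=
    (continuous_eps E (ct τ e)).comp hv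
  refine continuous_of_closed_cover (s := {p | eps E (ct τ e) p.2.1 ≤ rad τ e p.2.1})
    (t := {p | eps E (ct τ e) p.2.1 ≤ 2 * rad τ e p.2.1 ∧ rad τ e p.2.1 ≤ eps E (ct τ e) p.2.1})
    (u := {p | 2 * rad τ e p.2.1 ≤ eps E (ct τ e) p.2.1})
    (isClosed_le hE hr) ((isClosed_le hE (hr.const_mul 2)).inter (isClosed_le hr hE))
    (isClosed_le (hr.const_mul 2) hE) (fun p => ?_) ?_ ?_ ?_
  · simp only [Set.mem_ofPred_eq]
    have := le_total (eps E (ct τ e) p.2.1) (rad τ e p.2.1)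
    have := le_total (eps E (ct τ e) p.2.1) (2 * rad τ e p.2.1)
    tauto
  · refine (hF.comp (f := fun p : {p : T × MS n E τ | eps E (ct τ e) p.2.1 ≤ rad τ e p.2.1} =>
      (p.1.1, ⟨p.1.2.1, mem_of_le p.2⟩)) ?_).congr fun p => ?_
    · fun_prop
    · exact (glue_of_le (x := p.1.2) p.2).symm
  · refine (hK.comp (f := fun p : {p : T × MS n E τ | eps E (ct τ e) p.2.1 ≤ 2 * rad τ e p.2.1 ∧
      rad τ e p.2.1 ≤ eps E (ct τ e) p.2.1} =>
      (p.1.1, cl (2 - 2 * rad τ e p.1.2.1 / eps E (ct τ e) p.1.2.1),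
        (⟨p.1.2.1, (eps_pos _ _ _).1 (eps_pos_of_rad'' p.2.1 p.2.2)⟩, dirE τ e p.1.2.1)))
        ?_).congr fun p => ?_
    · have hr' := hr.comp (continuous_subtype_val (p := fun p : T × MS n E τ =>
        eps E (ct τ e) p.2.1 ≤ 2 * rad τ e p.2.1 ∧ rad τ e p.2.1 ≤ eps E (ct τ e) p.2.1))
      have hE' := hE.comp (continuous_subtype_val (p := fun p : T × MS n E τ =>
        eps E (ct τ e) p.2.1 ≤ 2 * rad τ e p.2.1 ∧ rad τ e p.2.1 ≤ eps E (ct τ e) p.2.1))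
      have hv' := hv.comp (continuous_subtype_val (p := fun p : T × MS n E τ =>
        eps E (ct τ e) p.2.1 ≤ 2 * rad τ e p.2.1 ∧ rad τ e p.2.1 ≤ eps E (ct τ e) p.2.1))
      refine (continuous_fst.comp continuous_subtype_val).prodMk ((continuous_cl.comp
        (continuous_const.sub ((hr'.const_mul 2).div hE' fun p =>
          (eps_pos_of_rad'' p.2.1 p.2.2).ne'))).prodMk ((hv'.subtype_mk _).prodMk ?_))
      exact continuous_nrm (((continuous_apply _).comp hv').sub ((continuous_apply _).comp hv'))
        fun p => norm_pos_iff.1 (rad_pos_of_le p.2.1)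
    · exact (glue_mid he (h0 _) p.2.1 p.2.2).symm
  · refine (hf.comp (f := fun p : {p : T × MS n E τ | 2 * rad τ e p.2.1 ≤ eps E (ct τ e) p.2.1} =>
      (p.1.1, ⟨p.1.2.1, (eps_pos _ _ _).1 (eps_pos_of_rad' p.2)⟩)) ?_).congr fun p => ?_
    · fun_prop
    · exact (glue_low (h1 _) (x := p.1.2) p.2).symm

end Glue

/-- The loop space. -/
def OmP (W : Pt) : Pt :=
  ⟨{γ : C(I, W.T) // γ 0 = W.pt ∧ γ 1 = W.pt}, ⟨ContinuousMap.const _ W.pt, rfl, rfl⟩⟩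

section Loops

variable {X Y Z : Type} [TopologicalSpace X] [TopologicalSpace Y] [TopologicalSpace Z] {W : Pt}

theorem OmP.continuous_mk {F : Z → (OmP W).T}
    (h : Continuous fun x : Z × I => (F x.1).1 x.2) : Continuous F :=
  continuous_induced_rng.2 (ContinuousMap.continuous_of_continuous_uncurry _ h)

theorem OmP.continuous_ev {F : Z → (OmP W).T} {g : Z → I} (hF : Continuous F)
    (hg : Continuous g) : Continuous fun z => (F z).1 (g z) := by
  have : Continuous fun z => (F z).1 := continuous_subtype_val.comp hF
  fun_prop

/-- The loop of maps determined by a map to the loop space. -/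
def loopOf (F : C(X, (OmP W).T)) : Path (MapSp X W).pt (MapSp X W).pt :=
  ⟨⟨fun t => (show C(X, W.T) from ⟨fun x => (F x).1 t, OmP.continuous_ev F.continuous continuous_const⟩),
    MapSp.continuous_mk (OmP.continuous_ev (F.continuous.comp continuous_snd) continuous_fst)⟩,
    MapSp.ext' fun x => (F x).2.1, MapSp.ext' fun x => (F x).2.2⟩

/-- The homotopy class of a map to the loop space. -/
def lcls (F : C(X, (OmP W).T)) : (MapSp X W).pi := cls (loopOf F)

theorem lcls_surj [LocallyCompactSpace X] (z : (MapSp X W).pi) : ∃ F, lcls F = z := by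
  obtain ⟨p, rfl⟩ := cls_surj z
  refine ⟨⟨fun x => ⟨⟨fun t => (show C(X, W.T) from p t) x,
    MapSp.continuous_ev p.continuous continuous_const⟩,
    congrArg (fun f : C(X, W.T) => f x) p.source, congrArg (fun f : C(X, W.T) => f x) p.target⟩,
    OmP.continuous_mk (MapSp.continuous_ev (F := fun z : X × I => p z.2) (g := Prod.fst)
      (p.continuous.comp continuous_snd) continuous_fst)⟩, rfl⟩

theorem lcls_eq [LocallyCompactSpace X] {F G : C(X, (OmP W).T)} :
    lcls F = lcls G ↔ F.Homotopic G := by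
  rw [lcls, lcls, cls_eq_iff]
  constructor
  · rintro ⟨H, h0, h1, h2, h3⟩
    refine ⟨⟨⟨fun p => ⟨⟨fun t => (show C(X, W.T) from H (p.1, t)) p.2,
      MapSp.continuous_ev (H.continuous.comp (by fun_prop)) continuous_const⟩,
      congrArg (fun f : C(X, W.T) => f p.2) (h2 _), congrArg (fun f : C(X, W.T) => f p.2) (h3 _)⟩,
      OmP.continuous_mk (MapSp.continuous_ev (F := fun p : (I × X) × I => H (p.1.1, p.2))
        (H.continuous.comp (by fun_prop)) (by fun_prop))⟩, fun x => ?_, fun x => ?_⟩⟩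
    · exact Subtype.ext (ContinuousMap.ext fun t => congrArg (fun f : C(X, W.T) => f x) (h0 t))
    · exact Subtype.ext (ContinuousMap.ext fun t => congrArg (fun f : C(X, W.T) => f x) (h1 t))
  · rintro ⟨H⟩
    refine ⟨⟨fun p => (show C(X, W.T) from ⟨fun x => (H (p.1, x)).1 p.2,
      OmP.continuous_ev (by fun_prop) continuous_const⟩), MapSp.continuous_mk
      (OmP.continuous_ev (F := fun p : (I × I) × X => H (p.1.1, p.2)) (by fun_prop) (by fun_prop))⟩,
      fun t => ?_, fun t => ?_, fun s => ?_, fun s => ?_⟩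
    · exact MapSp.ext' fun x => congrArg (fun γ => γ.1 t) (H.apply_zero x)
    · exact MapSp.ext' fun x => congrArg (fun γ => γ.1 t) (H.apply_one x)
    · exact MapSp.ext' fun x => (H (s, x)).2.1
    · exact MapSp.ext' fun x => (H (s, x)).2.2

theorem pre_lcls (h : C(X, Y)) (F : C(Y, (OmP W).T)) :
    (pre W h).pi (lcls F) = lcls (F.comp h) := by
  rw [lcls, PHom.pi_cls]
  rfl

theorem lcls_const : lcls (ContinuousMap.const X (OmP W).pt) = 1 := by
  rw [← cls_refl]
  rfl

end Loops

section Gluing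

variable {m n : ℕ} {E : List (Fin m × Fin m)} {τ : Fin m → Fin m} {e : Fin m × Fin m}

theorem scale_mem (x : MS n E τ) (μ : ℝ)
    (h : μ = 1 ∨ (0 < eps E (ct τ e) x.1 ∧ |μ| * rad τ e x.1 ≤ eps E (ct τ e) x.1)) :
    ∀ e' ∈ E, pv (τ e.1) (τ e.2) x.1 (μ • (x.1 (τ e.2) - x.1 (τ e.1))) (τ e'.1) ≠
      pv (τ e.1) (τ e.2) x.1 (μ • (x.1 (τ e.2) - x.1 (τ e.1))) (τ e'.2) := by
  rcases h with rfl | ⟨h0, h⟩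
  · rw [one_smul, pv_self]
    exact x.2
  · exact pv_mem h0 (by rwa [norm_smul, Real.norm_eq_abs])

theorem rad_pos (x : MS n (e :: E) τ) : 0 < rad τ e x.1 :=
  norm_pos_iff.2 (sub_ne_zero.2 (x.2 e List.mem_cons_self).symm)

/-- The expansion factor. -/
noncomputable def expF (E : List (Fin m × Fin m)) (τ : Fin m → Fin m) (e : Fin m × Fin m)
    (t : ℝ) (x : Amb m n) : ℝ :=
  max 1 (t * eps E (ct τ e) x / rad τ e x)

theorem expF_mul_rad (t : ℝ) (x : MS n (e :: E) τ) :
    expF E τ e t x.1 * rad τ e x.1 = max (rad τ e x.1) (t * eps E (ct τ e) x.1) := by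
  rw [expF, max_mul_of_nonneg _ _ (rad_nonneg _), one_mul, div_mul_cancel₀ _ (rad_pos x).ne']

theorem expand_mem (he : τ e.1 ≠ τ e.2) (p : I × MS n (e :: E) τ) : ∀ e' ∈ e :: E,
    pv (τ e.1) (τ e.2) p.2.1 (expF E τ e p.1 p.2.1 • (p.2.1 (τ e.2) - p.2.1 (τ e.1))) (τ e'.1) ≠
    pv (τ e.1) (τ e.2) p.2.1 (expF E τ e p.1 p.2.1 • (p.2.1 (τ e.2) - p.2.1 (τ e.1))) (τ e'.2) := by
    have h1 : 1 ≤ expF E τ e p.1 p.2.1 := le_max_left _ _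
    refine (mem_cons_iff e).2 ⟨?_, ?_⟩
    · rw [pv_ne _ _ he, pv_j]
      intro h
      refine smul_ne_zero ?_ ?_ (left_eq_add.1 h)
      · linarith
      · exact sub_ne_zero.2 (p.2.2 e List.mem_cons_self).symm
    · refine scale_mem (jj n E τ e p.2) _ ?_
      change expF E τ e p.1 p.2.1 = 1 ∨ (0 < eps E (ct τ e) p.2.1 ∧
        |expF E τ e p.1 p.2.1| * rad τ e p.2.1 ≤ eps E (ct τ e) p.2.1)
      rw [abs_of_nonneg (by linarith), expF_mul_rad]
      have ht := mul_le_of_le_one_left (eps_nonneg E (ct τ e) p.2.1) p.1.2.2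
      rcases le_or_gt (eps E (ct τ e) p.2.1) (rad τ e p.2.1) with h | h
      · left
        rw [expF, max_eq_left]
        exact div_le_one_of_le₀ (ht.trans h) (rad_nonneg _)
      · right
        exact ⟨(rad_nonneg _).trans_lt h, max_le h.le ht⟩

theorem continuous_displace {X : Type} [TopologicalSpace X] {f : X → Amb m n} {g : X → ℝ} {i j : Fin m}
    (hf : Continuous f) (hg : Continuous g) :
    Continuous fun x => pv i j (f x) (g x • (f x j - f x i)) :=
  continuous_pv hf (hg.smul (((continuous_apply j).comp hf).sub ((continuous_apply i).comp hf)))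

theorem continuous_expF : Continuous fun p : I × MS n (e :: E) τ => expF E τ e p.1 p.2.1 := by
  have hv : Continuous fun p : I × MS n (e :: E) τ => p.2.1 := by fun_prop
  have hr : Continuous fun p : I × MS n (e :: E) τ => rad τ e p.2.1 := continuous_rad.comp hv
  have hE : Continuous fun p : I × MS n (e :: E) τ => eps E (ct τ e) p.2.1 :=
    (continuous_eps E (ct τ e)).comp hv
  exact continuous_const.max
    (((continuous_subtype_val.comp continuous_fst).mul hE).div hr fun p => (rad_pos p.2).ne')

/-- Pushing the end points of an edge apart. -/
noncomputable def expand (n : ℕ) (E : List (Fin m × Fin m)) (τ : Fin m → Fin m) {e : Fin m × Fin m}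
    (he : τ e.1 ≠ τ e.2) :
    C(I × MS n (e :: E) τ, MS n (e :: E) τ) :=
  ⟨fun p => ⟨pv (τ e.1) (τ e.2) p.2.1 (expF E τ e p.1 p.2.1 • (p.2.1 (τ e.2) - p.2.1 (τ e.1))),
    expand_mem he p⟩, (continuous_displace (f := fun p : I × MS n (e :: E) τ => p.2.1)
      (by fun_prop) continuous_expF).subtype_mk _⟩

theorem expand_zero (he : τ e.1 ≠ τ e.2) (x : MS n (e :: E) τ) : expand n E τ he (0, x) = x := by
  apply Subtype.ext
  change pv _ _ _ (expF E τ e ((0 : I) : ℝ) x.1 • _) = _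
  simp [expF, pv_self]

theorem le_rad_expand (he : τ e.1 ≠ τ e.2) (x : MS n (e :: E) τ) :
    eps E (ct τ e) (expand n E τ he (1, x)).1 ≤ rad τ e (expand n E τ he (1, x)).1 := by
  change eps E (ct τ e) (pv _ _ _ _) ≤ rad τ e (pv _ _ _ _)
  rw [eps_pv he, rad_pv he, norm_smul, Real.norm_of_nonneg (zero_le_one.trans (show 1 ≤ expF E τ e _ _ from le_max_left _ _))]
  change _ ≤ expF E τ e _ x.1 * rad τ e x.1
  rw [expF_mul_rad]
  simp

theorem exists_extension {W : Pt} (he : τ e.1 ≠ τ e.2) (g : (MapSp (MS n (e :: E) τ) W).pi)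
    (a : (MapSp (MS n E (ct τ e)) W).pi)
    (h : (pre W (cc n E τ he)).pi g = (pre W ContinuousMap.fst).pi a) :
    ∃ g', (pre W (jj n E τ e)).pi g' = g := by
  obtain ⟨F, rfl⟩ := lcls_surj g
  obtain ⟨f, rfl⟩ := lcls_surj a
  rw [pre_lcls, pre_lcls, lcls_eq] at h
  obtain ⟨K⟩ := h
  have hc := continuous_glue (T := Unit) (F := fun _ => F) (f := fun _ => f)
    (K := fun _ t p => K (t, p)) he (by fun_prop) (by fun_prop) (by fun_prop)
    (fun _ p => K.apply_zero p) (fun _ p => K.apply_one p)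
  let G : C(MS n E τ, (OmP W).T) := ⟨fun x => glue F f (fun t p => K (t, p)) x,
    hc.comp (f := fun x => ((), x)) (by fun_prop)⟩
  refine ⟨lcls G, ?_⟩
  rw [pre_lcls, lcls_eq]
  let F1 : C(MS n (e :: E) τ, (OmP W).T) := ⟨fun x => F (expand n E τ he (1, x)), by fun_prop⟩
  refine ContinuousMap.Homotopic.trans (g := F1) ?_ ?_
  · refine ⟨⟨(G.comp (jj n E τ e)).comp (expand n E τ he), fun x => ?_, fun x => ?_⟩⟩
    · change G (jj n E τ e (expand n E τ he (0, x))) = G (jj n E τ e x)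
      rw [expand_zero]
    · exact glue_of_le (F := F) (f := f) (K := fun t p => K (t, p)) (x := jj n E τ e (expand n E τ he (1, x))) (le_rad_expand he x)
  · symm
    refine ⟨⟨F.comp (expand n E τ he), fun x => ?_, fun x => rfl⟩⟩
    exact congrArg F (expand_zero he x)

/-- The contraction factor. -/
noncomputable def conF (E : List (Fin m × Fin m)) (τ : Fin m → Fin m) (e : Fin m × Fin m)
    (x : Amb m n) : ℝ :=
  max 0 (min 1 ((2 * rad τ e x - eps E (ct τ e) x) / max (rad τ e x) (eps E (ct τ e) x / 2)))

theorem max_rad_pos (x : MS n E τ) : 0 < max (rad τ e x.1) (eps E (ct τ e) x.1 / 2) := by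
  rcases le_or_gt (eps E (ct τ e) x.1) (2 * rad τ e x.1) with h | h
  · exact lt_max_of_lt_left (rad_pos_of_le h)
  · exact lt_max_of_lt_right (by have := rad_nonneg (τ := τ) (e := e) x.1; linarith)

theorem conF_of_le (x : MS n E τ) (h : eps E (ct τ e) x.1 ≤ rad τ e x.1) : conF E τ e x.1 = 1 := by
  have h0 := rad_nonneg (τ := τ) (e := e) x.1
  have h1 := rad_pos_of_le (x := x) (e := e) (by linarith)
  rw [conF, max_eq_left (a := rad τ e x.1) (by linarith), min_eq_left, max_eq_right zero_le_one]
  rw [le_div_iff₀ h1]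
  linarith

theorem conF_of_ge (x : MS n E τ) (h : 2 * rad τ e x.1 ≤ eps E (ct τ e) x.1) :
    conF E τ e x.1 = 0 := by
  rw [conF, max_eq_left]
  refine (min_le_right _ _).trans (div_nonpos_of_nonpos_of_nonneg (by linarith) (max_rad_pos x).le)

theorem conF_mid (x : MS n E τ) (h : eps E (ct τ e) x.1 ≤ 2 * rad τ e x.1)
    (h' : rad τ e x.1 ≤ eps E (ct τ e) x.1) :
    conF E τ e x.1 = (2 * rad τ e x.1 - eps E (ct τ e) x.1) / rad τ e x.1 := by
  have h0 := rad_nonneg (τ := τ) (e := e) x.1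
  have h1 := rad_pos_of_le (x := x) (e := e) h
  rw [conF, max_eq_left (a := rad τ e x.1) (by linarith), min_eq_right, max_eq_right]
  · exact div_nonneg (by linarith) h0
  · rw [div_le_one h1]
    linarith

theorem contr_mem (p : I × MS n E τ) : ∀ e' ∈ E,
    pv (τ e.1) (τ e.2) p.2.1 (((1 - p.1) + p.1 * conF E τ e p.2.1 : ℝ) •
      (p.2.1 (τ e.2) - p.2.1 (τ e.1))) (τ e'.1) ≠
    pv (τ e.1) (τ e.2) p.2.1 (((1 - p.1) + p.1 * conF E τ e p.2.1 : ℝ) •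
      (p.2.1 (τ e.2) - p.2.1 (τ e.1))) (τ e'.2) := by
  refine scale_mem p.2 _ ?_
  rcases le_or_gt (eps E (ct τ e) p.2.1) (rad τ e p.2.1) with h | h
  · left
    rw [conF_of_le _ h]
    ring
  · right
    have hp := (rad_nonneg _).trans_lt h
    refine ⟨hp, (mul_le_of_le_one_left (rad_nonneg _) ?_).trans h.le⟩
    have h0 : 0 ≤ conF E τ e p.2.1 := le_max_left _ _
    have h1 : conF E τ e p.2.1 ≤ 1 := max_le zero_le_one (min_le_left _ _)
    have h2 := p.1.2.1
    have h3 := p.1.2.2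
    rw [abs_le]
    constructor <;> nlinarith

theorem continuous_conF : Continuous fun p : MS n E τ => conF E τ e p.1 := by
  have hr : Continuous fun p : MS n E τ => rad τ e p.1 := continuous_rad.comp continuous_subtype_val
  have hE : Continuous fun p : MS n E τ => eps E (ct τ e) p.1 :=
    (continuous_eps E (ct τ e)).comp continuous_subtype_val
  exact continuous_const.max (continuous_const.min (((hr.const_mul 2).sub hE).div
    (hr.max (hE.div_const 2)) fun p => (max_rad_pos p).ne'))

/-- Pulling the end points of an edge together. -/
noncomputable def contr (n : ℕ) (E : List (Fin m × Fin m)) (τ : Fin m → Fin m) (e : Fin m × Fin m) :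
    C(I × MS n E τ, MS n E τ) :=
  ⟨fun p => ⟨pv (τ e.1) (τ e.2) p.2.1
    (((1 - p.1) + p.1 * conF E τ e p.2.1 : ℝ) • (p.2.1 (τ e.2) - p.2.1 (τ e.1))), contr_mem p⟩,
    (continuous_displace (f := fun p : I × MS n E τ => p.2.1) (by fun_prop)
      (by have := continuous_conF (n := n) (E := E) (τ := τ) (e := e)
          have := this.comp (continuous_snd (X := I))
          simp only [Function.comp_def] at this
          fun_prop)).subtype_mk _⟩

theorem contr_zero (x : MS n E τ) : contr n E τ e (0, x) = x := by
  apply Subtype.ext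
  simp [contr, pv_self]

theorem contr_one (x : MS n E τ) : (contr n E τ e (1, x)).1 =
    pv (τ e.1) (τ e.2) x.1 (conF E τ e x.1 • (x.1 (τ e.2) - x.1 (τ e.1))) := by
  simp [contr]

theorem comp_contr_one {Z : Type} [TopologicalSpace Z] (he : τ e.1 ≠ τ e.2) (F : C(MS n E τ, Z))
    (x : MS n E τ) : F (contr n E τ e (1, x)) =
      glue (fun x => F (jj n E τ e x)) (fun y => F (bb n E τ e y))
        (fun t p => F (radPt n E τ e (σ t, p))) x := by
  rcases le_total (eps E (ct τ e) x.1) (rad τ e x.1) with h | h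
  · rw [glue_of_le h]
    congr 1
    apply Subtype.ext
    rw [contr_one, conF_of_le x h, one_smul, pv_self]
    rfl
  rcases le_total (eps E (ct τ e) x.1) (2 * rad τ e x.1) with h' | h'
  · rw [glue_mid he _ h' h]
    swap
    · intro p
      rw [unitInterval.symm_zero]
      rfl
    congr 1
    apply Subtype.ext
    rw [contr_one, conF_mid x h' h]
    change _ = pv _ _ _ _
    congr 1
    have h0 := rad_pos_of_le h'
    have h1 : 0 < eps E (ct τ e) x.1 := h0.trans_le h
    rw [← rad_smul_dirE, smul_smul]
    congr 1
    rw [unitInterval.coe_symm_eq, div_mul_cancel₀ _ h0.ne', Set.coe_projIcc]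
    have h3 : 2 * rad τ e x.1 / eps E (ct τ e) x.1 ≤ 2 := by
      rw [div_le_iff₀ h1]; linarith
    have h4 : 1 ≤ 2 * rad τ e x.1 / eps E (ct τ e) x.1 := by
      rw [le_div_iff₀ h1]; linarith
    rw [min_eq_right (by linarith), max_eq_right (by linarith)]
    field_simp
    ring
  · rw [glue_low _ h']
    swap
    · intro p
      rw [unitInterval.symm_one, radPt_zero]
    congr 1
    apply Subtype.ext
    rw [contr_one, conF_of_ge x h', zero_smul]
    rfl

end Gluing

section Paths

variable {X Y Z : Type} [TopologicalSpace X] [TopologicalSpace Y] [TopologicalSpace Z]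

/-- Precomposition of paths of maps. -/
def prePath (h : C(X, Y)) {f g : C(Y, Z)} {f' g' : C(X, Z)} (p : Path f g) (hf : f.comp h = f')
    (hg : g.comp h = g') : Path f' g' :=
  (p.map (ContinuousMap.continuous_precomp h)).cast hf.symm hg.symm

/-- Precomposition of homotopy classes of paths of maps. -/
def preQ (h : C(X, Y)) {f g : C(Y, Z)} {f' g' : C(X, Z)} (p : Path.Homotopic.Quotient f g)
    (hf : f.comp h = f') (hg : g.comp h = g') : Path.Homotopic.Quotient f' g' :=
  (p.map ⟨fun f => ContinuousMap.comp f h, ContinuousMap.continuous_precomp h⟩).cast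
    hf.symm hg.symm

theorem preQ_mk (h : C(X, Y)) {f g : C(Y, Z)} {f' g' : C(X, Z)} (p : Path f g)
    (hf : f.comp h = f') (hg : g.comp h = g') :
    preQ h (.mk p) hf hg = .mk (prePath h p hf hg) := rfl

theorem preQ_trans (h : C(X, Y)) {f g k : C(Y, Z)} {f' g' k' : C(X, Z)}
    (p : Path.Homotopic.Quotient f g) (q : Path.Homotopic.Quotient g k)
    (hf : f.comp h = f') (hg : g.comp h = g') (hk : k.comp h = k') :
    preQ h (p.trans q) hf hk = (preQ h p hf hg).trans (preQ h q hg hk) := by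
  subst hf hg hk
  induction p using Path.Homotopic.Quotient.ind with | mk p
  induction q using Path.Homotopic.Quotient.ind with | mk q
  rw [← Path.Homotopic.Quotient.mk_trans, preQ_mk, preQ_mk, preQ_mk,
    ← Path.Homotopic.Quotient.mk_trans]
  exact congrArg Path.Homotopic.Quotient.mk (Path.map_trans p q (ContinuousMap.continuous_precomp h))

theorem preQ_symm (h : C(X, Y)) {f g : C(Y, Z)} {f' g' : C(X, Z)}
    (p : Path.Homotopic.Quotient f g) (hf : f.comp h = f') (hg : g.comp h = g') :
    preQ h p.symm hg hf = (preQ h p hf hg).symm := by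
  subst hf hg
  induction p using Path.Homotopic.Quotient.ind
  rfl

theorem exists_path_of_homotopic {f g : C(X, Z)} (h : f.Homotopic g) : Nonempty (Path f g) := by
  obtain ⟨H⟩ := h
  exact ⟨⟨H.curry, ContinuousMap.ext fun x => H.apply_zero x,
    ContinuousMap.ext fun x => H.apply_one x⟩⟩

end Paths

section Gluing

variable {m n : ℕ} {E : List (Fin m × Fin m)} {τ : Fin m → Fin m} {e : Fin m × Fin m}
  {Z : Type} [TopologicalSpace Z]

theorem pi_pre_eq_preQ {X Y : Type} [TopologicalSpace X] [TopologicalSpace Y] {W : Pt} (h : C(X, Y))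
    (x : (MapSp Y W).pi) : (pre W h).pi x = preQ (f := ContinuousMap.const Y W.pt)
      (g := ContinuousMap.const Y W.pt) (f' := ContinuousMap.const X W.pt)
      (g' := ContinuousMap.const X W.pt) h x rfl rfl := by
  obtain ⟨p, rfl⟩ := cls_surj x
  rw [PHom.pi_cls]
  rfl

/-- The radial path. -/
noncomputable def radPath (he : τ e.1 ≠ τ e.2) (F : C(MS n E τ, Z)) :
    Path ((F.comp (bb n E τ e)).comp (ContinuousMap.fst (β := sph n)))
      ((F.comp (jj n E τ e)).comp (cc n E τ he)) :=
  ⟨(F.comp (radPt n E τ e)).curry, ContinuousMap.ext fun p => congrArg F (radPt_zero p),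
    ContinuousMap.ext fun p => congrArg F (radPt_one he p)⟩

theorem bb_fst_homotopic (he : τ e.1 ≠ τ e.2) :
    ((bb n E τ e).comp ContinuousMap.fst).Homotopic ((jj n E τ e).comp (cc n E τ he)) :=
  ⟨⟨radPt n E τ e, radPt_zero, radPt_one he⟩⟩

theorem homotopic_const_of_gluing (he : τ e.1 ≠ τ e.2) (F : C(MS n E τ, Z)) (z : Z)
    (K : Path (F.comp (jj n E τ e)) (ContinuousMap.const _ z))
    (h : Path (F.comp (bb n E τ e)) (ContinuousMap.const _ z))
    (H : Path.Homotopic ((radPath he F).trans (prePath (cc n E τ he) K rfl rfl))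
      (prePath (g' := ContinuousMap.const _ z) (ContinuousMap.fst (β := sph n)) h rfl rfl)) :
    F.Homotopic (ContinuousMap.const _ z) := by
  obtain ⟨H⟩ := H
  have hH0 : ∀ u p, H (u, 0) p = F (bb n E τ e p.1) := fun u p =>
    congrArg (fun f : C(MS n E (ct τ e) × sph n, Z) => f p) (Path.Homotopy.source H u)
  have hH1 : ∀ u p, H (u, 1) p = z := fun u p =>
    congrArg (fun f : C(MS n E (ct τ e) × sph n, Z) => f p) (Path.Homotopy.target H u)
  let L : I → I → MS n E (ct τ e) × sph n → Z := fun t s p =>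
    H (cl (s * min (2 * (t : ℝ)) 1),
      cl ((1 - s) * ((1 + t) / 2) + s * max 0 (2 * (t : ℝ) - 1))) p
  have hcl := continuous_cl
  have hK : Continuous fun p : I × MS n (e :: E) τ => K p.1 p.2 :=
    (K.continuous.comp continuous_fst).eval continuous_snd
  have hh : Continuous fun p : I × MS n E (ct τ e) => h (cl (2 * p.1 - 1)) p.2 :=
    (h.continuous.comp (hcl.comp (by fun_prop))).eval continuous_snd
  have hL : Continuous fun p : I × (I × (MS n E (ct τ e) × sph n)) => L p.1 p.2.1 p.2.2 := by
    refine Continuous.eval (H.continuous.comp ?_) (by fun_prop)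
    fun_prop
  have hL0 : ∀ t p, L t 0 p = K t (cc n E τ he p) := by
    intro t p
    have h1 := t.2.1
    simp only [L, Set.Icc.coe_zero, zero_mul, sub_zero, one_mul, add_zero]
    rw [cl_of_le le_rfl, H.apply_zero, Path.coe_toContinuousMap, Path.trans_apply]
    by_cases hc : ((cl ((1 + (t : ℝ)) / 2) : I) : ℝ) ≤ 1 / 2
    · rw [dif_pos hc]
      have h2 : ((cl ((1 + (t : ℝ)) / 2) : I) : ℝ) = (1 + t) / 2 := by
        rw [Set.coe_projIcc, min_eq_right (by have := t.2.2; linarith), max_eq_right (by linarith)]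
      obtain rfl : t = 0 := Subtype.ext (le_antisymm (by
        rw [h2] at hc
        change (t : ℝ) ≤ 0
        linarith) h1)
      have : (⟨2 * ((cl ((1 + ((0 : I) : ℝ)) / 2) : I) : ℝ), (unitInterval.mul_pos_mem_iff zero_lt_two).2
        ⟨(cl _).2.1, hc⟩⟩ : I) = 1 := Subtype.ext (by
          change 2 * ((cl ((1 + ((0 : I) : ℝ)) / 2) : I) : ℝ) = 1
          rw [h2]; simp)
      rw [this, Path.target, K.source]
      rfl
    · rw [dif_neg hc]
      change K _ _ = _
      congr 2
      apply Subtype.ext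
      change 2 * ((cl ((1 + (t : ℝ)) / 2) : I) : ℝ) - 1 = t
      rw [Set.coe_projIcc, min_eq_right (by have := t.2.2; linarith), max_eq_right (by linarith)]
      ring
  have hL1 : ∀ t p, L t 1 p = h (cl (2 * (t : ℝ) - 1)) p.1 := by
    intro t p
    simp only [L, Set.Icc.coe_one, one_mul, sub_self, zero_mul, zero_add]
    rcases le_total (1 / 2) (t : ℝ) with ht | ht
    · rw [cl_of_ge (by rw [min_eq_right (by linarith)]), max_eq_right (by linarith), H.apply_one]
      rfl
    · rw [max_eq_left (by linarith), cl_of_le le_rfl, cl_of_le (x := 2 * (t : ℝ) - 1) (by linarith),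
        hH0, h.source]
      rfl
  have hG := continuous_glue (T := I) he (F := fun t x => K t x)
    (f := fun t y => h (cl (2 * t - 1)) y) (K := L) hK hh hL hL0 hL1
  let F1 : C(MS n E τ, Z) := ⟨fun x => F (contr n E τ e (1, x)), by fun_prop⟩
  refine ContinuousMap.Homotopic.trans (g := F1) ⟨⟨F.comp (contr n E τ e), fun x => ?_, fun x => rfl⟩⟩
    ⟨⟨⟨_, hG⟩, fun x => ?_, fun x => ?_⟩⟩
  · exact congrArg F (contr_zero x)
  · change _ = F (contr n E τ e (1, x))
    rw [comp_contr_one he]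
    change glue _ _ _ _ = _
    congr 1
    · funext y
      rw [K.source]
      rfl
    · funext y
      rw [cl_of_le (by simp), h.source]
      rfl
    · funext s p
      have h1 := s.2.1
      have h2 := s.2.2
      have h3 : (1 - (s : ℝ)) * ((1 + ((0 : I) : ℝ)) / 2) + s * max 0 (2 * ((0 : I) : ℝ) - 1) =
        (1 - s) / 2 := by simp; ring
      have h4 : ((cl ((1 - (s : ℝ)) / 2) : I) : ℝ) = (1 - s) / 2 := by
        rw [Set.coe_projIcc, min_eq_right (by linarith), max_eq_right (by linarith)]
      simp only [L]
      rw [h3, cl_of_le (x := (s : ℝ) * min (2 * ((0 : I) : ℝ)) 1) (by simp), H.apply_zero,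
        Path.coe_toContinuousMap, Path.trans_apply, dif_pos (by rw [h4]; linarith)]
      change F (radPt n E τ e (_, p)) = _
      congr 3
      apply Subtype.ext
      change 2 * ((cl ((1 - (s : ℝ)) / 2) : I) : ℝ) = 1 - s
      rw [h4]
      ring
  · change glue _ _ _ _ = z
    have hK1 : ∀ x, K 1 x = z := fun x => by rw [K.target]; rfl
    have hh1 : ∀ x, h (cl (2 * ((1 : I) : ℝ) - 1)) x = z := fun x => by
      rw [cl_of_ge (by norm_num), h.target]; rfl
    have hL1 : ∀ s p, L 1 s p = z := fun s p => by
      simp only [L]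
      rw [cl_of_ge (x := (1 - (s : ℝ)) * ((1 + ((1 : I) : ℝ)) / 2) + s * max 0 (2 * ((1 : I) : ℝ) - 1))
        (by norm_num), hH1]
    rw [glue]
    split_ifs
    · exact hK1 _
    · exact hL1 _ _
    · exact hh1 _

theorem eq_one_of_pre_jj_eq_one {W : Pt} (he : τ e.1 ≠ τ e.2)
    (hd : ∀ l : (MapSp (MS n E (ct τ e) × sph n) (OmP W)).pi,
      ∃ (E' : (MapSp (MS n (e :: E) τ) (OmP W)).pi) (a : (MapSp (MS n E (ct τ e)) (OmP W)).pi),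
        l = (pre _ (cc n E τ he)).pi E' * (pre _ ContinuousMap.fst).pi a)
    (g : (MapSp (MS n E τ) W).pi) (hg : (pre W (jj n E τ e)).pi g = 1) : g = 1 := by
  have hb : (pre W (bb n E τ e)).pi g = 1 := by
    have h1 : (pre W (incPt (MS n E (ct τ e)) n)).pi ((pre W (cc n E τ he)).pi
        ((pre W (jj n E τ e)).pi g)) = 1 := by rw [hg, map_one, map_one]
    rw [pre_pre (cc n E τ he), ← pre_htpy (bb_fst_homotopic he), pre_pre] at h1
    exact h1
  obtain ⟨F, rfl⟩ := lcls_surj g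
  rw [pre_lcls, ← lcls_const, lcls_eq] at hg hb
  rw [← lcls_const, lcls_eq]
  obtain ⟨K⟩ := exists_path_of_homotopic hg
  obtain ⟨h⟩ := exists_path_of_homotopic hb
  let cM : C(MS n (e :: E) τ, (OmP W).T) := ContinuousMap.const _ (OmP W).pt
  let cB : C(MS n E (ct τ e), (OmP W).T) := ContinuousMap.const _ (OmP W).pt
  let c : C(MS n E (ct τ e) × sph n, (OmP W).T) := ContinuousMap.const _ (OmP W).pt
  have hM : cM.comp (cc n E τ he) = c := rfl
  have hB : cB.comp ContinuousMap.fst = c := rfl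
  let r := Path.Homotopic.Quotient.mk (radPath he F)
  let k : Path.Homotopic.Quotient (F.comp (jj n E τ e)) cM := .mk K
  let q : Path.Homotopic.Quotient (F.comp (bb n E τ e)) cB := .mk h
  let k' := preQ (cc n E τ he) k rfl hM
  let q' := preQ (ContinuousMap.fst (β := sph n)) q rfl hB
  obtain ⟨E', a, hl⟩ : ∃ (x : Path.Homotopic.Quotient cM cM) (a : Path.Homotopic.Quotient cB cB),
    q'.symm.trans (r.trans k') = (preQ (ContinuousMap.fst (β := sph n)) a hB hB).trans
      (preQ (cc n E τ he) x hM hM) := by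
    obtain ⟨E', a, hl⟩ := hd (q'.symm.trans (r.trans k'))
    refine ⟨E', a, hl.trans ?_⟩
    rw [pi_pre_eq_preQ, pi_pre_eq_preQ]
    rfl
  obtain ⟨K', hK'⟩ := Path.Homotopic.Quotient.mk_surjective (k.trans E'.symm)
  obtain ⟨h', hh'⟩ := Path.Homotopic.Quotient.mk_surjective (q.trans a)
  refine homotopic_const_of_gluing he F _ K' h' (Path.Homotopic.Quotient.exact ?_)
  change r.trans (preQ (cc n E τ he) (.mk K') rfl hM) =
    preQ (ContinuousMap.fst (β := sph n)) (.mk h') rfl hB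
  rw [hK', hh', preQ_trans _ _ _ _ hM, preQ_trans _ _ _ _ hB, preQ_symm]
  change r.trans (k'.trans _) = q'.trans _
  rw [← Path.Homotopic.Quotient.trans_assoc, ← Path.Homotopic.Quotient.refl_trans (r.trans k'),
    ← Path.Homotopic.Quotient.trans_symm q', Path.Homotopic.Quotient.trans_assoc q', hl]
  simp only [Path.Homotopic.Quotient.trans_assoc, Path.Homotopic.Quotient.trans_symm,
    Path.Homotopic.Quotient.trans_refl]

end Gluing

section Bijection

variable {m n : ℕ} {E : List (Fin m × Fin m)} {τ : Fin m → Fin m} {e : Fin m × Fin m}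

open Classical in
/-- The deletion-contraction tree of a list of edges. -/
noncomputable def tree {m : ℕ} : List (Fin m × Fin m) → (Fin m → Fin m) → Tr (Fin m × Fin m)
  | [], _ => .leaf
  | e :: E, τ => if τ e.1 = τ e.2 then .zero else .node e (tree E (ct τ e)) (tree E τ)

theorem tree_cons_eq (he : τ e.1 = τ e.2) : tree (e :: E) τ = .zero := by
  rw [tree, if_pos he]

theorem tree_cons_ne (he : τ e.1 ≠ τ e.2) :
    tree (e :: E) τ = .node e (tree E (ct τ e)) (tree E τ) := by
  rw [tree, if_neg he]

theorem tree_all (E : List (Fin m × Fin m)) (τ : Fin m → Fin m) : (tree E τ).All (· ∈ E) := by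
  induction E generalizing τ with
  | nil => exact trivial
  | cons e E ih =>
    by_cases he : τ e.1 = τ e.2
    · rw [tree_cons_eq he]
      exact trivial
    · rw [tree_cons_ne he]
      exact ⟨List.mem_cons_self, (ih _).mono fun _ => List.mem_cons_of_mem _,
        (ih _).mono fun _ => List.mem_cons_of_mem _⟩

theorem pre_cc_eta {W : Pt} (he : τ e.1 ≠ τ e.2) {t : Tr (Fin m × Fin m)} (ht : t.All (· ∈ E))
    (b : Tr.Co n t (Lam n W)) :
    (pre W (cc n E τ he)).pi ((eta W (dirM n (e :: E) τ e)).pi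
      (Phi (MS n (e :: E) τ) (dirM n (e :: E) τ) t (Lam n W) b)) =
    kap W (MS n E (ct τ e)) n (Phi (MS n E (ct τ e)) (dirM n E (ct τ e)) t (Lam n W) b) := by
  rw [pre_eta, dirM_cc, pre_Phi, Phi_htpy _ _ _ _ _ (ht.mono fun e' h => dirM_cc_htpy he h),
    ← pre_Phi]
  rfl

theorem pre_jj_Phi {W : Pt} {t : Tr (Fin m × Fin m)} (ht : t.All (· ∈ E)) (b : Tr.Co n t W) :
    (pre W (jj n E τ e)).pi (Phi (MS n E τ) (dirM n E τ) t W b) =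
      Phi (MS n (e :: E) τ) (dirM n (e :: E) τ) t W b := by
  rw [pre_Phi]
  exact Phi_htpy _ _ _ _ _ (ht.mono fun e' h => by rw [dirM_jj h])

theorem pre_cc_jj {W : Pt} (he : τ e.1 ≠ τ e.2) (g : (MapSp (MS n E τ) W).pi) :
    (pre W (cc n E τ he)).pi ((pre W (jj n E τ e)).pi g) =
      (pre W ContinuousMap.fst).pi ((pre W (bb n E τ e)).pi g) := by
  rw [pre_pre, ← pre_htpy (bb_fst_homotopic he), pre_pre]

theorem pre_incPt_fst {W : Pt} {Y : Type} [TopologicalSpace Y] (z : (MapSp Y W).pi) :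
    (pre W (incPt Y n)).pi ((pre W ContinuousMap.fst).pi z) = z := by
  rw [pre_pre]
  exact pre_id z

theorem exists_factor {W : Pt} (he : τ e.1 ≠ τ e.2)
    (hs : Function.Surjective (Phi (MS n E (ct τ e)) (dirM n E (ct τ e)) (tree E (ct τ e)) (Lam n W)))
    (l : (MapSp (MS n E (ct τ e) × sph n) W).pi) :
    ∃ b, l = (pre W (cc n E τ he)).pi ((eta W (dirM n (e :: E) τ e)).pi
        (Phi (MS n (e :: E) τ) (dirM n (e :: E) τ) (tree E (ct τ e)) (Lam n W) b)) *
      (pre W ContinuousMap.fst).pi ((pre W (incPt (MS n E (ct τ e)) n)).pi l) := by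
  obtain ⟨z, hz⟩ := exists_kap (l * ((pre W ContinuousMap.fst).pi
    ((pre W (incPt (MS n E (ct τ e)) n)).pi l))⁻¹) (by
      rw [map_mul, map_inv, pre_incPt_fst, mul_inv_cancel])
  obtain ⟨b, rfl⟩ := hs z
  exact ⟨b, by rw [pre_cc_eta he (tree_all _ _), hz, inv_mul_cancel_right]⟩

theorem pre_jj_injective {W : Pt} (he : τ e.1 ≠ τ e.2)
    (hs : ∀ W, Function.Surjective
      (Phi (MS n E (ct τ e)) (dirM n E (ct τ e)) (tree E (ct τ e)) W)) :
    Function.Injective (pre W (jj n E τ e)).pi := by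
  rw [injective_iff_map_eq_one]
  refine fun g hg => eq_one_of_pre_jj_eq_one he (fun l => ?_) g hg
  obtain ⟨b, hb⟩ := exists_factor he (hs _) l
  exact ⟨_, _, hb⟩

theorem contractible_MS_nil (m n : ℕ) (τ : Fin m → Fin m) :
    ∃ (y : MS n [] τ), (ContinuousMap.id (MS n [] τ)).Homotopic (ContinuousMap.const _ y) :=
  ⟨⟨0, by simp⟩, ⟨⟨⟨fun p => ⟨(1 - (p.1 : ℝ)) • p.2.1, fun _ h => absurd h List.not_mem_nil⟩,
    Continuous.subtype_mk (p := fun x : Amb m n => ∀ e ∈ ([] : List (Fin m × Fin m)),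
      x (τ e.1) ≠ x (τ e.2)) ((continuous_const.sub (continuous_subtype_val.comp continuous_fst)).smul
      (continuous_subtype_val.comp continuous_snd)) fun _ _ h => absurd h List.not_mem_nil⟩,
    fun x => by ext1; simp, fun x => by ext1; simp⟩⟩⟩

theorem cst_bijective {X : Type} [TopologicalSpace X] [LocallyCompactSpace X] (W : Pt)
    (h : ∃ y : X, (ContinuousMap.id X).Homotopic (ContinuousMap.const _ y)) :
    Function.Bijective (cst X W).pi := by
  obtain ⟨y, hy⟩ := h
  let ev : PHom (MapSp X W) W := ⟨⟨fun f => (show C(X, W.T) from f) y,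
    MapSp.continuous_ev (F := fun f => f) continuous_id continuous_const⟩, rfl⟩
  have h1 : ∀ z, ev.pi ((cst X W).pi z) = z := fun z => by
    rw [PHom.pi_comp]
    exact PHom.pi_id _ (fun _ => rfl) z
  have h2 : ∀ z, (cst X W).pi (ev.pi z) = z := fun z => by
    rw [PHom.pi_comp]
    conv_rhs => rw [← pre_id z, pre_htpy hy]
    rfl
  exact Function.bijective_iff_has_inverse.2 ⟨ev.pi, h1, h2⟩

theorem Phi_bijective (E : List (Fin m × Fin m)) (τ : Fin m → Fin m) (W : Pt) :
    Function.Bijective (Phi (MS n E τ) (dirM n E τ) (tree E τ) W) := by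
  induction E generalizing τ W with
  | nil =>
    have h := cst_bijective W (contractible_MS_nil m n τ)
    refine ⟨fun b c hbc => ?_, fun z => ?_⟩
    · funext a
      exact h.1 hbc
    · obtain ⟨y, hy⟩ := h.2 z
      exact ⟨fun _ => y, hy⟩
  | cons e E ih =>
    by_cases he : τ e.1 = τ e.2
    · rw [tree_cons_eq he]
      have : IsEmpty (MS n (e :: E) τ) := ⟨fun x => x.2 e List.mem_cons_self (by rw [he])⟩
      have hsub : ∀ z : (MapSp (MS n (e :: E) τ) W).pi, z = 1 := fun z => by
        obtain ⟨p, rfl⟩ := cls_surj z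
        rw [← cls_refl]
        congr 1
        ext t
        exact MapSp.ext' fun x => isEmptyElim x
      refine ⟨fun b c _ => funext fun a => ?_, fun z => ⟨fun a => ?_, ?_⟩⟩
      · exact nomatch (show Empty from a)
      · exact nomatch (show Empty from a)
      · rw [hsub z, hsub (Phi _ _ _ _ _)]
    · rw [tree_cons_ne he]
      have hj := pre_jj_injective (n := n) (W := W) he fun W => (ih (ct τ e) W).2
      have hcc : ∀ b : Tr.Co n (.node e (tree E (ct τ e)) (tree E τ)) W,
          (pre W (cc n E τ he)).pi (Phi (MS n (e :: E) τ) (dirM n (e :: E) τ) _ W b) =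
          kap W (MS n E (ct τ e)) n (Phi (MS n E (ct τ e)) (dirM n E (ct τ e)) _ (Lam n W) b.left) *
          (pre W ContinuousMap.fst).pi ((pre W (bb n E τ e)).pi
            (Phi (MS n E τ) (dirM n E τ) _ W b.right)) := fun b => by
        rw [Phi, map_mul, pre_cc_eta he (tree_all _ _), ← pre_jj_Phi (tree_all _ _), pre_cc_jj]
      refine ⟨fun b c hbc => ?_, fun g => ?_⟩
      · have h1 := congrArg (pre W (cc n E τ he)).pi hbc
        rw [hcc, hcc] at h1
        have h2 := congrArg (pre W (incPt (MS n E (ct τ e)) n)).pi h1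
        rw [map_mul, map_mul, pre_incPt_kap, pre_incPt_kap, one_mul, one_mul, pre_incPt_fst,
          pre_incPt_fst] at h2
        rw [h2] at h1
        have h3 := (ih _ _).1 (kap_injective (mul_right_cancel h1))
        refine Tr.Co.ext_node h3 ((ih _ _).1 (hj ?_))
        rw [Phi, Phi, h3] at hbc
        rw [pre_jj_Phi (tree_all _ _), pre_jj_Phi (tree_all _ _)]
        exact mul_left_cancel hbc
      · obtain ⟨b, hb⟩ := exists_factor he (ih _ _).2 ((pre W (cc n E τ he)).pi g)
        set δ := (eta W (dirM n (e :: E) τ e)).pi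
          (Phi (MS n (e :: E) τ) (dirM n (e :: E) τ) (tree E (ct τ e)) (Lam n W) b) with hδ
        obtain ⟨g', hg'⟩ := exists_extension he (δ⁻¹ * g) _ (by
          rw [map_mul, map_inv]
          exact inv_mul_eq_iff_eq_mul.2 hb)
        obtain ⟨c, rfl⟩ := (ih _ _).2 g'
        refine ⟨Tr.Co.mk b c, ?_⟩
        rw [pre_jj_Phi (tree_all _ _)] at hg'
        rw [Phi]
        change δ * Phi _ _ _ _ c = g
        rw [hg', mul_inv_cancel_left]

end Bijection

section Smash

variable {A B : Type}

/-- The product of one-point compactifications maps to the one-point compactification of the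
product. -/
def opProd : OnePoint A × OnePoint B → OnePoint (A × B)
  | (some a, some b) => ((a, b) : A × B)
  | _ => OnePoint.infty

theorem opProd_eq_infty_iff (p : OnePoint A × OnePoint B) :
    opProd p = OnePoint.infty ↔ p.1 = OnePoint.infty ∨ p.2 = OnePoint.infty := by
  rcases p with ⟨_ | a, _ | b⟩
  · exact ⟨fun _ => Or.inl rfl, fun _ => rfl⟩
  · exact ⟨fun _ => Or.inl rfl, fun _ => rfl⟩
  · exact ⟨fun _ => Or.inr rfl, fun _ => rfl⟩
  · change (((a, b) : A × B) : OnePoint (A × B)) = _ ↔ (a : OnePoint A) = _ ∨ (b : OnePoint B) = _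
    simp

theorem opProd_inj {p q : OnePoint A × OnePoint B} (h : opProd p = opProd q)
    (hp : opProd p ≠ OnePoint.infty) : p = q := by
  rcases p with ⟨_ | a, _ | b⟩
  · exact absurd rfl hp
  · exact absurd rfl hp
  · exact absurd rfl hp
  · rcases q with ⟨_ | c, _ | d⟩
    · exact absurd h hp
    · exact absurd h hp
    · exact absurd h hp
    · change (((a, b) : A × B) : OnePoint (A × B)) = ((c, d) : A × B) at h
      obtain ⟨rfl, rfl⟩ := Prod.mk.inj (OnePoint.coe_injective h)
      rfl

theorem opProd_surjective : Function.Surjective (opProd : OnePoint A × OnePoint B → _) := by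
  rintro (_ | ⟨a, b⟩)
  · exact ⟨(OnePoint.infty, OnePoint.infty), rfl⟩
  · exact ⟨((a : OnePoint A), (b : OnePoint B)), rfl⟩

theorem opProd_preimage {s : Set (OnePoint (A × B))} (h : OnePoint.infty ∉ s) :
    opProd ⁻¹' s = Prod.map ((↑) : A → OnePoint A) ((↑) : B → OnePoint B) '' ((↑) ⁻¹' s) := by
  ext p
  constructor
  · intro hp
    rcases p with ⟨_ | a, _ | b⟩
    · exact absurd hp h
    · exact absurd hp h
    · exact absurd hp h
    · exact ⟨(a, b), hp, rfl⟩
  · rintro ⟨⟨a, b⟩, hq, rfl⟩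
    exact hq

theorem continuous_opProd [TopologicalSpace A] [TopologicalSpace B] [T2Space A]
    [T2Space B] [LocallyCompactSpace A] [LocallyCompactSpace B] :
    Continuous (opProd : OnePoint A × OnePoint B → _) := by
  refine continuous_def.2 fun s hs => ?_
  by_cases h : OnePoint.infty ∈ s
  · rw [← isClosed_compl_iff, ← Set.preimage_compl, opProd_preimage (by simpa using h)]
    refine IsCompact.isClosed (IsCompact.image ?_ (OnePoint.continuous_coe.prodMap
      OnePoint.continuous_coe))
    exact ((OnePoint.isOpen_iff_of_mem h).1 hs).2
  · rw [opProd_preimage h]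
    exact (OnePoint.isOpenEmbedding_coe.prodMap OnePoint.isOpenEmbedding_coe).isOpenMap _
      (hs.preimage OnePoint.continuous_coe)

theorem exists_smash (a n : ℕ) : ∃ π : C(sph a × sph n, sph (a + n)), Function.Surjective π ∧
    (∀ p, π p = sphBase (a + n) ↔ p.1 = sphBase a ∨ p.2 = sphBase n) ∧
    ∀ p q, π p = π q → π p ≠ sphBase (a + n) → p = q := by
  have hv : ∀ k, ‖(sphBase k).1‖ = 1 := fun k => mem_sphere_zero_iff_norm.1 (sphBase k).2
  let h := fun k => onePointHyperplaneHomeoUnitSphere (hv k)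
  have hi : ∀ k, h k OnePoint.infty = sphBase k := fun k => rfl
  have hr : ∀ k, Module.finrank ℝ (Submodule.span ℝ {(sphBase k).1})ᗮ = k := fun k => by
    have : Fact (Module.finrank ℝ (EuclideanSpace ℝ (Fin (k + 1))) = k + 1) := ⟨by simp⟩
    exact Submodule.finrank_orthogonal_span_singleton
      (norm_ne_zero_iff.1 (by rw [hv k]; norm_num))
  let L : ((Submodule.span ℝ {(sphBase a).1})ᗮ × (Submodule.span ℝ {(sphBase n).1})ᗮ) ≃L[ℝ]
    (Submodule.span ℝ {(sphBase (a + n)).1})ᗮ := ContinuousLinearEquiv.ofFinrankEq (by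
      rw [Module.finrank_prod, hr, hr, hr])
  let f := L.toHomeomorph.onePointCongr.trans (h (a + n))
  have hf : f OnePoint.infty = sphBase (a + n) := rfl
  have hfi : ∀ y, f y = sphBase (a + n) ↔ y = OnePoint.infty := fun y => by
    rw [← hf, f.injective.eq_iff]
  have hs : ∀ k x, (h k).symm x = OnePoint.infty ↔ x = sphBase k := fun k x => by
    rw [Homeomorph.symm_apply_eq, hi]
  let g := fun p : sph a × sph n => ((h a).symm p.1, (h n).symm p.2)
  have hg : Continuous g := by fun_prop
  refine ⟨⟨fun p => f (opProd (g p)), f.continuous.comp (continuous_opProd.comp hg)⟩, ?_, ?_, ?_⟩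
  · intro y
    obtain ⟨y, rfl⟩ := f.surjective y
    obtain ⟨⟨b, c⟩, rfl⟩ := opProd_surjective y
    exact ⟨(h a b, h n c), by simp [g]⟩
  · intro p
    change f (opProd (g p)) = _ ↔ _
    rw [hfi, opProd_eq_infty_iff, hs, hs]
  · intro p q hpq hp
    have := opProd_inj (f.injective hpq) (by rwa [Ne, ← hfi])
    simpa [g, Prod.ext_iff] using this

end Smash

section Circle

/-- The exponential map from the unit interval onto the circle. -/
noncomputable def expI : C(I, sph 1) :=
  ⟨fun t => ⟨!₂[Real.cos (2 * Real.pi * t), Real.sin (2 * Real.pi * t)], by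
    rw [mem_sphere_zero_iff_norm, EuclideanSpace.norm_eq]
    simp⟩, by
    refine Continuous.subtype_mk ?_ _
    fun_prop⟩

theorem expI_zero : expI 0 = sphBase 1 := by
  apply Subtype.ext
  ext i
  fin_cases i <;> simp [expI, sphBase]

theorem expI_one : expI 1 = sphBase 1 := by
  apply Subtype.ext
  ext i
  fin_cases i <;> simp [expI, sphBase]

theorem expI_inj {s t : I} (h : expI s = expI t) : s = t ∨ (s = 0 ∨ s = 1) ∧ (t = 0 ∨ t = 1) := by
  have h1 : Real.cos (2 * Real.pi * s) = Real.cos (2 * Real.pi * t) :=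
    congrArg (fun x : sph 1 => x.1 0) h
  have h2 : Real.sin (2 * Real.pi * s) = Real.sin (2 * Real.pi * t) :=
    congrArg (fun x : sph 1 => x.1 1) h
  obtain ⟨k, hk⟩ := Real.Angle.angle_eq_iff_two_pi_dvd_sub.1 (Real.Angle.cos_sin_inj h1 h2)
  rw [← mul_sub] at hk
  have hk' := mul_left_cancel₀ (by positivity) hk
  have hs := s.2
  have ht := t.2
  rw [Set.mem_Icc] at hs ht
  have hk1 : k ≤ 1 := by
    have : (k : ℝ) ≤ 1 := by linarith
    exact_mod_cast this
  have hk2 : -1 ≤ k := by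
    have : (-1 : ℝ) ≤ k := by linarith
    exact_mod_cast this
  simp only [Subtype.ext_iff, Set.Icc.coe_zero, Set.Icc.coe_one]
  interval_cases k
  · right
    push_cast at hk'
    exact ⟨Or.inl (by linarith), Or.inr (by linarith)⟩
  · left
    push_cast at hk'
    linarith
  · right
    push_cast at hk'
    exact ⟨Or.inr (by linarith), Or.inl (by linarith)⟩

theorem expI_surjective : Function.Surjective expI := by
  intro x
  have hx : x.1 0 ^ 2 + x.1 1 ^ 2 = 1 := by
    have := mem_sphere_zero_iff_norm.1 x.2
    rw [EuclideanSpace.norm_eq, Real.sqrt_eq_one] at this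
    simpa using this
  obtain ⟨θ, h1, h2⟩ : ∃ θ : ℝ, Real.cos θ = x.1 0 ∧ Real.sin θ = x.1 1 := by
    let z : ℂ := ⟨x.1 0, x.1 1⟩
    have hz : ‖z‖ = 1 := by
      rw [Complex.norm_def, Complex.normSq_mk, Real.sqrt_eq_one]
      linarith
    have hz0 : z ≠ 0 := norm_ne_zero_iff.1 (by rw [hz]; norm_num)
    exact ⟨z.arg, by rw [Complex.cos_arg hz0, hz, div_one], by rw [Complex.sin_arg, hz, div_one]⟩
  have hθ : 2 * Real.pi * Int.fract (θ / (2 * Real.pi)) = θ - ⌊θ / (2 * Real.pi)⌋ * (2 * Real.pi) := by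
    rw [Int.fract, mul_sub, mul_div_cancel₀ _ (by positivity)]
    ring
  refine ⟨⟨Int.fract (θ / (2 * Real.pi)), Int.fract_nonneg _, (Int.fract_lt_one _).le⟩, ?_⟩
  apply Subtype.ext
  ext i
  fin_cases i
  · change Real.cos (2 * Real.pi * Int.fract (θ / (2 * Real.pi))) = x.1 0
    rw [hθ, Real.cos_sub_int_mul_two_pi, h1]
  · change Real.sin (2 * Real.pi * Int.fract (θ / (2 * Real.pi))) = x.1 1
    rw [hθ, Real.sin_sub_int_mul_two_pi, h2]

end Circle

theorem LamN.map_comp {n : ℕ} : ∀ (k : ℕ) {A B C : Pt} (g : PHom B C) (f : PHom A B)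
    (z : (LamN n k A).pi),
    (LamN.map n k g).pi ((LamN.map n k f).pi z) = (LamN.map n k (g.comp f)).pi z
  | 0, _, _, _, g, f, z => PHom.pi_comp g f z
  | k + 1, _, _, _, g, f, z => LamN.map_comp k (Lam.map n g) (Lam.map n f) z

/-- An element of the fundamental group of an iterated mapping space which represents the
functor sending a space to this group, in the sense of pointed maps up to pointed homotopy. -/
structure IsRep (n k : ℕ) (Q : Pt) (v : (LamN n k Q).pi) : Prop where
  ex : ∀ (W : Pt) (b : (LamN n k W).pi), ∃ ψ : PHom Q W, (LamN.map n k ψ).pi v = b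
  uniq : ∀ (W : Pt) (ψ χ : PHom Q W), (LamN.map n k ψ).pi v = (LamN.map n k χ).pi v → ψ.Htpy χ

/-- The pointed sphere. -/
noncomputable def Sph (a : ℕ) : Pt := ⟨sph a, sphBase a⟩

/-- Descending continuous maps along a surjection from a compact space onto a Hausdorff space. -/
theorem exists_descend {X Y Z : Type} [TopologicalSpace X] [TopologicalSpace Y] [TopologicalSpace Z]
    [CompactSpace X] [T2Space Y] {π : X → Y} (hπ : Continuous π) (hs : Function.Surjective π)
    {f : X → Z} (hf : Continuous f) (h : ∀ x y, π x = π y → f x = f y) :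
    ∃ g : C(Y, Z), ∀ x, g (π x) = f x := by
  have hq : Topology.IsQuotientMap π := .of_surjective_continuous hs hπ
  let p : C(X, Y) := ⟨π, hπ⟩
  have hp : Topology.IsQuotientMap p := hq
  have h' : Function.FactorsThrough (⟨f, hf⟩ : C(X, Z)) p := fun x y => h x y
  exact ⟨hp.lift ⟨f, hf⟩ h', fun x => congrArg (fun k : C(X, Z) => k x) (hp.lift_comp _ h')⟩

theorem exists_circle_class : ∃ v : (Sph 1).pi,
    (∀ (W : Pt) (b : W.pi), ∃ ψ : PHom (Sph 1) W, ψ.pi v = b) ∧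
    ∀ (W : Pt) (ψ ψ' : PHom (Sph 1) W), ψ.pi v = ψ'.pi v → ψ.Htpy ψ' := by
  let p : Path (Sph 1).pt (Sph 1).pt := ⟨expI, expI_zero, expI_one⟩
  refine ⟨cls p, fun W b => ?_, fun W ψ ψ' h => ?_⟩
  · obtain ⟨q, rfl⟩ := cls_surj b
    have hq : ∀ t : I, t = 0 ∨ t = 1 → q t = W.pt := by
      rintro t (rfl | rfl)
      · exact q.source
      · exact q.target
    obtain ⟨g, hg⟩ := exists_descend expI.continuous expI_surjective q.continuous fun s t h => by
      rcases expI_inj h with rfl | ⟨h1, h2⟩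
      · rfl
      · rw [hq _ h1, hq _ h2]
    refine ⟨⟨g, ?_⟩, ?_⟩
    · change g (sphBase 1) = W.pt
      rw [← expI_zero, hg, hq 0 (Or.inl rfl)]
    · rw [PHom.pi_cls]
      congr 1
      ext t
      exact hg t
  · rw [PHom.pi_cls, PHom.pi_cls, cls_eq_iff] at h
    obtain ⟨H, h0, h1, h2, h3⟩ := h
    have hb : ∀ s t : I, t = 0 ∨ t = 1 → H (s, t) = W.pt := by
      rintro s t (rfl | rfl)
      · exact h2 s
      · exact h3 s
    obtain ⟨g, hg⟩ := exists_descend (π := fun x : I × I => (x.1, expI x.2)) (by fun_prop)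
      (fun y => by obtain ⟨t, ht⟩ := expI_surjective y.2; exact ⟨(y.1, t), by simp [ht]⟩)
      H.continuous fun x y h => by
        obtain ⟨hx, hy⟩ := Prod.mk.inj h
        rcases expI_inj hy with h4 | ⟨h4, h5⟩
        · rw [Prod.ext hx h4]
        · exact (hb _ _ h4).trans (hb _ _ h5).symm
    refine ⟨g, fun x => ?_, fun x => ?_, fun t => ?_⟩
    · obtain ⟨s, rfl⟩ := expI_surjective x
      exact (hg (0, s)).trans (h0 s)
    · obtain ⟨s, rfl⟩ := expI_surjective x
      exact (hg (1, s)).trans (h1 s)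
    · change g (t, sphBase 1) = W.pt
      rw [← expI_zero]
      exact (hg (t, 0)).trans (h2 t)

theorem exists_smash_class (a n : ℕ) : ∃ u : PHom (Sph a) (Lam n (Sph (a + n))),
    (∀ (W : Pt) (ψ : PHom (Sph a) (Lam n W)), ∃ φ : PHom (Sph (a + n)) W,
      (Lam.map n φ).comp u = ψ) ∧
    ∀ (W : Pt) (ψ ψ' : PHom (Sph (a + n)) W),
      ((Lam.map n ψ).comp u).Htpy ((Lam.map n ψ').comp u) → ψ.Htpy ψ' := by
  obtain ⟨π, hs, hb, hi⟩ := exists_smash a n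
  let u : PHom (Sph a) (Lam n (Sph (a + n))) :=
    ⟨⟨fun q => ⟨⟨fun θ => π (q, θ), π.continuous.comp (continuous_const.prodMk continuous_id)⟩, (hb _).2 (Or.inr rfl)⟩,
      Lam.continuous_mk π.continuous⟩, Lam.ext' fun θ => (hb (sphBase a, θ)).2 (Or.inl rfl)⟩
  refine ⟨u, fun W ψ => ?_, fun W ψ ψ' h => ?_⟩
  · have hw : ∀ p : sph a × sph n, π p = sphBase (a + n) →
        (show (Lam n W).T from ψ.f p.1).1 p.2 = W.pt := by
      rintro ⟨x, θ⟩ hp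
      rcases (hb _).1 hp with h | h
      · obtain rfl : x = sphBase a := h
        exact congrArg (fun f : (Lam n W).T => f.1 θ) ψ.map_pt
      · obtain rfl : θ = sphBase n := h
        exact (ψ.f x).2
    obtain ⟨g, hg⟩ := exists_descend π.continuous hs (f := fun p : sph a × sph n =>
        (show (Lam n W).T from ψ.f p.1).1 p.2)
      (Lam.continuous_ev (F := fun p : sph a × sph n => ψ.f p.1)
        (ψ.f.continuous.comp continuous_fst) continuous_snd) fun x y h => by
        by_cases hx : π x = sphBase (a + n)
        · rw [hw x hx, hw y (h.symm.trans hx)]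
        · rw [hi x y h hx]
    have hg0 : g (sphBase (a + n)) = W.pt := by
      have h0 := (hb (sphBase a, sphBase n)).2 (Or.inl rfl)
      rw [← h0, hg, hw _ h0]
    refine ⟨⟨g, hg0⟩, ?_⟩
    ext1
    ext1 x
    exact Lam.ext' fun θ => hg (x, θ)
  · obtain ⟨H, h0, h1, h2⟩ := h
    have hw : ∀ (t : I) (p : sph a × sph n), π p = sphBase (a + n) →
        (show (Lam n W).T from H (t, p.1)).1 p.2 = W.pt := by
      rintro t ⟨x, θ⟩ hp
      rcases (hb _).1 hp with h | h
      · obtain rfl : x = sphBase a := h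
        exact congrArg (fun f : (Lam n W).T => f.1 θ) (h2 t)
      · obtain rfl : θ = sphBase n := h
        exact (H (t, x)).2
    obtain ⟨g, hg⟩ := exists_descend (π := fun x : I × (sph a × sph n) => (x.1, π x.2))
      (by fun_prop)
      (fun y => by obtain ⟨p, hp⟩ := hs y.2; exact ⟨(y.1, p), by simp [hp]⟩)
      (f := fun x : I × (sph a × sph n) => (show (Lam n W).T from H (x.1, x.2.1)).1 x.2.2)
      (Lam.continuous_ev (F := fun x : I × (sph a × sph n) => H (x.1, x.2.1))
        (H.continuous.comp (by fun_prop)) (by fun_prop)) fun x y h => by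
        obtain ⟨hx, hy⟩ := Prod.mk.inj h
        by_cases hx' : π x.2 = sphBase (a + n)
        · rw [hw _ _ hx', hw _ _ (hy.symm.trans hx')]
        · rw [hx, hi _ _ hy hx']
    refine ⟨g, fun y => ?_, fun y => ?_, fun t => ?_⟩
    · obtain ⟨p, rfl⟩ := hs y
      exact (hg (0, p)).trans (congrArg (fun f : (Lam n W).T => f.1 p.2) (h0 p.1))
    · obtain ⟨p, rfl⟩ := hs y
      exact (hg (1, p)).trans (congrArg (fun f : (Lam n W).T => f.1 p.2) (h1 p.1))
    · have h3 := (hb (sphBase a, sphBase n)).2 (Or.inl rfl)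
      change g (t, sphBase (a + n)) = W.pt
      rw [← h3]
      exact (hg (t, (sphBase a, sphBase n))).trans (hw _ _ h3)

theorem exists_rep (n k : ℕ) : ∃ v, IsRep n k (Sph (k * n + 1)) v := by
  induction k with
  | zero =>
    rw [zero_mul]
    obtain ⟨v, h1, h2⟩ := exists_circle_class
    exact ⟨v, h1, h2⟩
  | succ k ih =>
    obtain ⟨v, hv⟩ := ih
    rw [show (k + 1) * n + 1 = k * n + 1 + n by ring]
    obtain ⟨u, h1, h2⟩ := exists_smash_class (k * n + 1) n
    have h : ∀ {W : Pt} (φ : PHom (Sph (k * n + 1 + n)) W),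
        (LamN.map n (k + 1) φ).pi ((LamN.map n k u).pi v) =
          (LamN.map n k ((Lam.map n φ).comp u)).pi v := fun φ => LamN.map_comp k _ _ _
    refine ⟨(LamN.map n k u).pi v, fun W b => ?_, fun W ψ ψ' hψ => ?_⟩
    · obtain ⟨ψ, hψ⟩ := hv.ex (Lam n W) b
      obtain ⟨φ, rfl⟩ := h1 W ψ
      exact ⟨φ, (h φ).trans hψ⟩
    · rw [h, h] at hψ
      exact h2 W ψ ψ' (hv.uniq _ _ _ hψ)

section Suspension

variable {M Z : Type} [TopologicalSpace M] [TopologicalSpace Z]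

/-- Points of the suspension of a space with a disjoint point, on the first part. -/
def suspL (x : M) (t : I) : Susp (M ⊕ PUnit.{1}) := Quot.mk _ (Sum.inl x, t)

/-- Points of the suspension of a space with a disjoint point, on the disjoint point. -/
def suspR (M : Type) [TopologicalSpace M] (t : I) : Susp (M ⊕ PUnit.{1}) := Quot.mk _ (Sum.inr ⟨⟩, t)

theorem suspL_zero (x : M) : suspL x 0 = suspR M 0 := Quot.sound (Or.inl ⟨rfl, rfl⟩)

theorem suspL_one (x : M) : suspL x 1 = suspR M 1 := Quot.sound (Or.inr ⟨rfl, rfl⟩)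

theorem continuous_suspL : Continuous fun p : M × I => suspL p.1 p.2 :=
  continuous_quot_mk.comp (by fun_prop)

theorem continuous_suspR : Continuous (suspR M) :=
  continuous_quot_mk.comp (by fun_prop)

theorem susp_cases {P : Susp (M ⊕ PUnit.{1}) → Prop} (hL : ∀ x t, P (suspL x t))
    (hR : ∀ t, P (suspR M t)) (y : Susp (M ⊕ PUnit.{1})) : P y := by
  obtain ⟨⟨x | ⟨⟩, t⟩, rfl⟩ := Quot.exists_rep y
  · exact hL x t
  · exact hR t

/-- Gluing homotopies on the two parts of the suspension. -/
theorem exists_susp_map (A : I → I → M → Z) (B : I → I → Z)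
    (hA : Continuous fun p : M × (I × I) => A p.2.1 p.2.2 p.1)
    (hB : Continuous fun p : I × I => B p.1 p.2) (h0 : ∀ s x, A s 0 x = B s 0)
    (h1 : ∀ s x, A s 1 x = B s 1) :
    ∃ H : C(I × Susp (M ⊕ PUnit.{1}), Z), (∀ s x t, H (s, suspL x t) = A s t x) ∧
      ∀ s t, H (s, suspR M t) = B s t := by
  let G : I → (M ⊕ PUnit.{1}) × I → Z := fun s y => Sum.elim (fun x => A s y.2 x) (fun _ => B s y.2) y.1
  have hz : ∀ s x, G s (x, 0) = B s 0 := by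
    rintro s (x | x)
    · exact h0 s x
    · rfl
  have ho : ∀ s x, G s (x, 1) = B s 1 := by
    rintro s (x | x)
    · exact h1 s x
    · rfl
  have hG : Continuous fun p : I × ((M ⊕ PUnit.{1}) × I) => G p.1 p.2 := by
    have h : Continuous (Sum.elim (fun p : M × (I × I) => A p.2.1 p.2.2 p.1)
      fun p : PUnit.{1} × (I × I) => B p.2.1 p.2.2) := hA.sumElim (hB.comp continuous_snd)
    have h' := h.comp (Homeomorph.sumProdDistrib (X := M) (Y := PUnit.{1}) (Z := I × I)).continuous
    convert h'.comp (f := fun p : I × ((M ⊕ PUnit.{1}) × I) => (p.2.1, (p.1, p.2.2))) (by fun_prop)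
      using 1
    funext p
    rcases p with ⟨s, x | x, t⟩ <;> rfl
  let g : I × Susp (M ⊕ PUnit.{1}) → Z := fun p => Quot.lift (G p.1) (by
    rintro ⟨x, t⟩ ⟨y, t'⟩ (⟨ht, ht'⟩ | ⟨ht, ht'⟩)
    · obtain rfl : t = 0 := ht
      obtain rfl : t' = 0 := ht'
      rw [hz, hz]
    · obtain rfl : t = 1 := ht
      obtain rfl : t' = 1 := ht'
      rw [ho, ho]) p.2
  exact ⟨⟨g, isQuotientMap_quot_mk.continuous_lift_prod_right hG⟩, fun _ _ _ => rfl, fun _ _ => rfl⟩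

/-- The suspension of a space with a disjoint point, pointed. -/
def suspPt (M : Type) [TopologicalSpace M] : Pt := ⟨Susp (M ⊕ PUnit.{1}), suspR M 0⟩

/-- The path of maps to the suspension. -/
def pathL (M : Type) [TopologicalSpace M] : Path (X := C(M, Susp (M ⊕ PUnit.{1})))
    (ContinuousMap.const M (suspR M 0)) (ContinuousMap.const M (suspR M 1)) :=
  ⟨⟨fun t => ⟨fun x => suspL x t, continuous_suspL.comp (f := fun x => (x, t)) (by fun_prop)⟩,
    ContinuousMap.continuous_of_continuous_uncurry _
      (continuous_suspL.comp (f := fun p : I × M => (p.2, p.1)) (by fun_prop))⟩,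
    ContinuousMap.ext suspL_zero, ContinuousMap.ext suspL_one⟩

/-- The path of constant maps to the suspension. -/
def pathR (M : Type) [TopologicalSpace M] : Path (X := C(M, Susp (M ⊕ PUnit.{1})))
    (ContinuousMap.const M (suspR M 0)) (ContinuousMap.const M (suspR M 1)) :=
  ⟨⟨fun t => ContinuousMap.const M (suspR M t),
    ContinuousMap.continuous_of_continuous_uncurry _
      (continuous_suspR.comp (f := fun p : I × M => p.1) (by fun_prop))⟩, rfl, rfl⟩

/-- The universal loop of maps to the suspension. -/
noncomputable def suspLoop (M : Type) [TopologicalSpace M] :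
    Path (MapSp M (suspPt M)).pt (MapSp M (suspPt M)).pt :=
  (pathL M).trans (pathR M).symm

/-- The loop of maps determined by a map on the suspension collapsing the second part. -/
def loopL {W : Pt} (θ : PHom (suspPt M) W) (h : ∀ t, θ.f (suspR M t) = W.pt) :
    Path (MapSp M W).pt (MapSp M W).pt :=
  ⟨⟨fun t => (show C(M, W.T) from ⟨fun x => θ.f (suspL x t),
      θ.f.continuous.comp (continuous_suspL.comp (f := fun x => (x, t)) (by fun_prop))⟩),
    MapSp.continuous_mk (θ.f.continuous.comp
      (continuous_suspL.comp (f := fun p : I × M => (p.2, p.1)) (by fun_prop)))⟩,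
    MapSp.ext' fun x => (congrArg θ.f (suspL_zero x)).trans (h 0),
    MapSp.ext' fun x => (congrArg θ.f (suspL_one x)).trans (h 1)⟩

theorem trans_cl {X : Type} [TopologicalSpace X] {a b c : X} (p : Path a b) (q : Path b c) (t : I) :
    p.trans q t = if (t : ℝ) ≤ 1 / 2 then p (cl (2 * (t : ℝ))) else q (cl (2 * (t : ℝ) - 1)) := by
  rw [Path.trans_apply]
  split_ifs with h
  · congr 1
    exact (cl_coe ⟨2 * (t : ℝ), _⟩).symm
  · congr 1
    exact (cl_coe ⟨2 * (t : ℝ) - 1, _⟩).symm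

theorem post_suspLoop {W : Pt} (θ : PHom (suspPt M) W) (h : ∀ t, θ.f (suspR M t) = W.pt) :
    (post M θ).pi (cls (suspLoop M)) = cls (loopL θ h) := by
  rw [PHom.pi_cls]
  have : (post M θ).mapPath (suspLoop M) = (loopL θ h).trans (Path.refl _) := by
    ext t
    have h1 : suspLoop M t = _ := trans_cl (pathL M) (pathR M).symm t
    rw [PHom.mapPath_apply, trans_cl, h1]
    split_ifs
    · rfl
    · exact MapSp.ext' fun x => h _
  rw [this, ← cls_mul, cls_refl, one_mul]

theorem homotopic_of_map {X Y : Type} [TopologicalSpace X] [TopologicalSpace Y] {f g : C(X, Y)}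
    (H : C(I × X, Y)) (h0 : ∀ x, H (0, x) = f x) (h1 : ∀ x, H (1, x) = g x) : f.Homotopic g :=
  ⟨⟨H, h0, h1⟩⟩

/-- A pointed self-map of the suspension fixing the universal class and collapsing the second part
is homotopic to the identity. -/
theorem homotopic_id_of_suspLoop [LocallyCompactSpace M] (θ : PHom (suspPt M) (suspPt M))
    (h : ∀ t, θ.f (suspR M t) = suspR M 0)
    (hθ : (post M θ).pi (cls (suspLoop M)) = cls (suspLoop M)) :
    (show C(Susp (M ⊕ PUnit.{1}), Susp (M ⊕ PUnit.{1})) from θ.f).Homotopic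
      (ContinuousMap.id _) := by
  rw [post_suspLoop θ h] at hθ
  let c0 : C(M, Susp (M ⊕ PUnit.{1})) := ContinuousMap.const M (suspR M 0)
  let q : Path c0 c0 := loopL θ h
  have hq : q.Homotopic ((pathL M).trans (pathR M).symm) := cls_eq.1 hθ
  have hK : Path.Homotopic (pathL M) (q.trans (pathR M)) := by
    rw [← Path.Homotopic.Quotient.eq] at hq ⊢
    rw [Path.Homotopic.Quotient.mk_trans, hq, Path.Homotopic.Quotient.mk_trans,
      Path.Homotopic.Quotient.mk_symm, Path.Homotopic.Quotient.trans_assoc,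
      Path.Homotopic.Quotient.symm_trans, Path.Homotopic.Quotient.trans_refl]
  let pR : Path (suspR M 0) (suspR M 1) := ⟨⟨suspR M, continuous_suspR⟩, rfl, rfl⟩
  obtain ⟨K⟩ := hK
  let J := (Path.Homotopy.transRefl q).symm
  let L := (Path.Homotopy.reflTrans pR).symm
  have hpath : ∀ {f g : C(M, Susp (M ⊕ PUnit.{1}))} {p p' : Path f g} (K : p.Homotopy p'),
      Continuous fun x : M × (I × I) => K (x.2.1, x.2.2) x.1 := fun K =>
    (K.continuous.comp (f := fun x : M × (I × I) => (x.2.1, x.2.2)) (by fun_prop)).eval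
      continuous_fst
  obtain ⟨H1, hH1, hH1'⟩ := exists_susp_map (fun s t x => K (s, t) x) (fun s t => L (s, t))
    (hpath K) L.continuous (fun s x => by rw [K.source, L.source]; rfl)
    (fun s x => by rw [K.target, L.target]; rfl)
  obtain ⟨H3, hH3, hH3'⟩ := exists_susp_map (fun s t x => J (s, t) x) (fun _ _ => suspR M 0)
    (hpath J) continuous_const (fun s x => by rw [J.source]; rfl)
    (fun s x => by rw [J.target]; rfl)
  let c : I → I → I := fun s t => cl (s * (2 * (t : ℝ) - 1))
  have hc : Continuous fun p : I × I => c p.1 p.2 :=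
    continuous_cl.comp (f := fun p : I × I => (p.1 : ℝ) * (2 * (p.2 : ℝ) - 1)) (by fun_prop)
  let A : I → I → M → Susp (M ⊕ PUnit.{1}) := fun s t x =>
    if (t : ℝ) ≤ 1 / 2 then q (cl (2 * (t : ℝ))) x else suspR M (c s t)
  let B : I → I → Susp (M ⊕ PUnit.{1}) := fun s t =>
    if (t : ℝ) ≤ 1 / 2 then suspR M 0 else suspR M (c s t)
  have hc0 : ∀ s t : I, (t : ℝ) = 1 / 2 → c s t = 0 := fun s t ht => cl_of_le (by rw [ht]; simp)
  have hq' : Continuous fun p : M × (I × I) => q (cl (2 * (p.2.2 : ℝ))) p.1 :=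
    (q.continuous.comp (continuous_cl.comp
      (f := fun p : M × (I × I) => 2 * (p.2.2 : ℝ)) (by fun_prop))).eval continuous_fst
  obtain ⟨H2, hH2, hH2'⟩ := exists_susp_map A B
    (Continuous.if_le hq'
      (continuous_suspR.comp (hc.comp continuous_snd)) (by fun_prop) (by fun_prop) fun x hx => by
        rw [hc0 _ _ hx, hx, cl_of_ge (by norm_num), q.target]
        rfl)
    (Continuous.if_le continuous_const (continuous_suspR.comp hc) (by fun_prop) (by fun_prop)
      fun x hx => by
        rw [hc0 _ _ hx])
    (fun s x => by
      simp only [A, B]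
      rw [if_pos (by simp), if_pos (by simp), cl_of_le (by simp), q.source]
      rfl)
    (fun s x => by simp only [A, B]; rw [if_neg (by norm_num), if_neg (by norm_num)])
  refine (((homotopic_of_map (f := ContinuousMap.id _) (g := H1.comp (.prodMk (.const _ 1) (.id _)))
    H1 (susp_cases (fun x t => ?_) fun t => ?_) fun _ => rfl).trans
    (homotopic_of_map (f := H2.comp (.prodMk (.const _ 0) (.id _))) H2 (fun _ => rfl)
      (susp_cases (fun x t => ?_) fun t => ?_)).symm).trans
    (homotopic_of_map H3 (susp_cases (fun x t => ?_) fun t => ?_)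
      (susp_cases (fun x t => ?_) fun t => ?_)).symm).symm
  · rw [hH1, K.apply_zero]
    rfl
  · rw [hH1', L.apply_zero]
    rfl
  · change H2 _ = H1 (1, suspL x t)
    rw [hH1, hH2, K.apply_one]
    have h1 := trans_cl q (pathR M) t
    simp only [A, c]
    change _ = (q.trans (pathR M)) t x
    rw [h1]
    split_ifs
    · rfl
    · rw [Set.Icc.coe_one, one_mul]
      rfl
  · change H2 _ = H1 (1, suspR M t)
    rw [hH1', hH2', L.apply_one]
    have h1 := trans_cl (Path.refl (suspR M 0)) pR t
    simp only [B, c]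
    change _ = ((Path.refl (suspR M 0)).trans pR) t
    rw [h1]
    split_ifs
    · rfl
    · rw [Set.Icc.coe_one, one_mul]
      rfl
  · rw [hH3, J.apply_zero]
    rfl
  · rw [hH3']
    exact (h t).symm
  · change H3 _ = H2 (0, suspL x t)
    rw [hH3, hH2, J.apply_one]
    have h1 := trans_cl q (Path.refl c0) t
    simp only [A, c]
    change (q.trans (Path.refl c0)) t x = _
    rw [h1]
    split_ifs
    · rfl
    · rw [Set.Icc.coe_zero, zero_mul, cl_of_le le_rfl]
      rfl
  · change H3 _ = H2 (0, suspR M t)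
    rw [hH3', hH2']
    simp only [B, c]
    split_ifs
    · rfl
    · rw [Set.Icc.coe_zero, zero_mul, cl_of_le le_rfl]

end Suspension

section Wedge

variable {ι : Type} {dims : ι → ℕ}

/-- The inclusion of a sphere into a wedge. -/
def wedgeIn (dims : ι → ℕ) (a : ι) (x : sph (dims a)) : WedgeSpheres ι dims := Quot.mk _ ⟨a, x⟩

theorem wedgeIn_base (a b : ι) : wedgeIn dims a (sphBase _) = wedgeIn dims b (sphBase _) :=
  Quot.sound ⟨rfl, rfl⟩

theorem continuous_wedgeIn (a : ι) : Continuous (wedgeIn dims a) :=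
  continuous_quot_mk.comp continuous_sigmaMk

/-- The pointed wedge. -/
noncomputable def wedgePt (dims : ι → ℕ) (a : ι) : Pt :=
  ⟨WedgeSpheres ι dims, wedgeIn dims a (sphBase _)⟩

variable {a₀ : ι}

/-- The pointed inclusion of a sphere into a wedge. -/
noncomputable def wedgeIncl (dims : ι → ℕ) (a₀ a : ι) : PHom (Sph (dims a)) (wedgePt dims a₀) :=
  ⟨⟨wedgeIn dims a, continuous_wedgeIn a⟩, wedgeIn_base _ _⟩

theorem wedge_cases {P : WedgeSpheres ι dims → Prop} (h : ∀ a x, P (wedgeIn dims a x))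
    (y : WedgeSpheres ι dims) : P y := by
  obtain ⟨⟨a, x⟩, rfl⟩ := Quot.exists_rep y
  exact h a x

theorem exists_wedge_prod {T Z : Type} [TopologicalSpace T] [LocallyCompactSpace T]
    [TopologicalSpace Z]
    (F : ∀ a, C(T × sph (dims a), Z)) (z : T → Z) (hz : ∀ a t, F a (t, sphBase _) = z t) :
    ∃ H : C(T × WedgeSpheres ι dims, Z), ∀ t a x, H (t, wedgeIn dims a x) = F a (t, x) := by
  let G : T → (Σ a, sph (dims a)) → Z := fun t y => F y.1 (t, y.2)
  have hG : Continuous fun p : T × (Σ a, sph (dims a)) => G p.1 p.2 := by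
    have h : Continuous fun p : Σ a, sph (dims a) × T => F p.1 (p.2.2, p.2.1) :=
      continuous_sigma fun a => (F a).continuous.comp continuous_swap
    have h' := (h.comp (Homeomorph.sigmaProdDistrib (X := fun a => sph (dims a))
      (Y := T)).continuous).comp (continuous_swap (X := T) (Y := Σ a, sph (dims a)))
    exact h'
  let g : T × WedgeSpheres ι dims → Z := fun p => Quot.lift (G p.1) (by
    rintro ⟨a, x⟩ ⟨b, y⟩ ⟨hx, hy⟩
    obtain rfl : x = sphBase _ := hx
    obtain rfl : y = sphBase _ := hy
    exact (hz a p.1).trans (hz b p.1).symm) p.2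
  exact ⟨⟨g, isQuotientMap_quot_mk.continuous_lift_prod_right hG⟩, fun _ _ _ => rfl⟩

theorem exists_wedge_map {W : Pt} (ψ : ∀ a, PHom (Sph (dims a)) W) :
    ∃ φ : PHom (wedgePt dims a₀) W, ∀ a, φ.comp (wedgeIncl dims a₀ a) = ψ a := by
  obtain ⟨H, hH⟩ := exists_wedge_prod (T := Unit) (dims := dims)
    (fun a => (ψ a).f.comp ⟨fun p => p.2, continuous_snd⟩) (fun _ => W.pt) fun a _ => (ψ a).map_pt
  refine ⟨⟨⟨fun y => H ((), y), H.continuous.comp (by fun_prop)⟩,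
    (hH () a₀ _).trans (ψ a₀).map_pt⟩, fun a => ?_⟩
  ext1
  ext1 x
  exact hH () a x

theorem wedge_htpy {W : Pt} {φ φ' : PHom (wedgePt dims a₀) W}
    (h : ∀ a, (φ.comp (wedgeIncl dims a₀ a)).Htpy (φ'.comp (wedgeIncl dims a₀ a))) :
    φ.Htpy φ' := by
  choose F h0 h1 h2 using h
  obtain ⟨H, hH⟩ := exists_wedge_prod F (fun _ => W.pt) h2
  exact ⟨H, wedge_cases fun a x => (hH 0 a x).trans (h0 a x),
    wedge_cases fun a x => (hH 1 a x).trans (h1 a x), fun t => (hH t a₀ _).trans (h2 a₀ t)⟩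

end Wedge

section Yoneda

open Tr

variable {D : Type} {n : ℕ} {M : Type} [TopologicalSpace M] [LocallyCompactSpace M]

theorem Co.map_map {t : Tr D} {A B C : Pt} (g : PHom B C) (f : PHom A B) (b : Co n t A) :
    (b.map f).map g = b.map (g.comp f) :=
  funext fun _ => LamN.map_comp _ _ _ _

theorem exists_susp_hom {W : Pt} (p : Path (MapSp M W).pt (MapSp M W).pt) :
    ∃ φ : PHom (suspPt M) W, (∀ t, φ.f (suspR M t) = W.pt) ∧
      (post M φ).pi (cls (suspLoop M)) = cls p := by
  have hp : Continuous fun x : M × (I × I) => (show C(M, W.T) from p x.2.2) x.1 :=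
    MapSp.continuous_ev (W := W) (F := fun x : M × (I × I) => p x.2.2)
      (p.continuous.comp (by fun_prop)) continuous_fst
  obtain ⟨H, hH, hH'⟩ := exists_susp_map (fun _ t x => (show C(M, W.T) from p t) x)
    (fun _ _ => W.pt) hp continuous_const
    (fun _ x => congrArg (fun f : C(M, W.T) => f x) p.source)
    (fun _ x => congrArg (fun f : C(M, W.T) => f x) p.target)
  let φ : PHom (suspPt M) W := ⟨⟨fun y => H (0, y), H.continuous.comp (by fun_prop)⟩, hH' 0 0⟩
  have hφ : ∀ t, φ.f (suspR M t) = W.pt := hH' 0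
  refine ⟨φ, hφ, ?_⟩
  rw [post_suspLoop φ hφ]
  congr 1
  ext t
  exact MapSp.ext' fun x => hH 0 x t

/-- If homotopy classes of loops of maps on `M` are classified by coefficients on the leaves of a
tree then the suspension of `M` with a disjoint point is a wedge of spheres. -/
theorem nonempty_homotopyEquiv_wedge (d : D → C(M, sph n)) (t : Tr D) (a₀ : t.ix)
    (hΦ : ∀ W, Function.Bijective (Phi M d t W)) :
    Nonempty (ContinuousMap.HomotopyEquiv (Susp (M ⊕ PUnit.{1}))
      (WedgeSpheres t.ix fun a => t.ht a * n + 1)) := by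
  let dims : t.ix → ℕ := fun a => t.ht a * n + 1
  let Y : Pt := wedgePt dims a₀
  choose vS hvS using fun a : t.ix => exists_rep n (t.ht a)
  let v : Co n t Y := fun a => (LamN.map n (t.ht a) (wedgeIncl dims a₀ a)).pi (vS a)
  have hv : ∀ {W : Pt} (φ : PHom Y W) (a : t.ix), v.map φ a =
      (LamN.map n (t.ht a) (φ.comp (wedgeIncl dims a₀ a))).pi (vS a) :=
    fun φ a => LamN.map_comp _ _ _ _
  obtain ⟨β, hβ⟩ := (hΦ (suspPt M)).2 (cls (suspLoop M))
  choose ψ' hψ' using fun a => (hvS a).ex (suspPt M) (β a)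
  obtain ⟨ψ, hψ⟩ := exists_wedge_map (a₀ := a₀) ψ'
  have hvψ : v.map ψ = β := by
    funext a
    rw [hv, hψ]
    exact hψ' a
  obtain ⟨p, hp⟩ := cls_surj (Phi M d t Y v)
  obtain ⟨φ, hφ, hφp⟩ := exists_susp_hom p
  rw [hp] at hφp
  have h1 : (post M (ψ.comp φ)).pi (cls (suspLoop M)) = cls (suspLoop M) := by
    rw [← post_post, hφp, post_Phi, hvψ, hβ]
  have h2 : v.map (φ.comp ψ) = v := by
    refine (hΦ Y).1 ?_
    rw [← Co.map_map, hvψ, ← post_Phi, hβ, hφp]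
  have h3 : (φ.comp ψ).Htpy ⟨ContinuousMap.id _, rfl⟩ := by
    refine wedge_htpy fun a => (hvS a).uniq _ _ _ ?_
    rw [← hv, h2]
    rfl
  obtain ⟨H, hH0, hH1, -⟩ := h3
  exact ⟨⟨φ.f, ψ.f, homotopic_id_of_suspLoop (ψ.comp φ)
    (fun t => (congrArg ψ.f (hφ t)).trans ψ.map_pt) h1, homotopic_of_map H hH0 hH1⟩⟩

end Yoneda

section Transport

/-- Reindexing a wedge of spheres. -/
theorem nonempty_wedge_homeomorph {ι ι' : Type} (dims : ι → ℕ) (dims' : ι' → ℕ) (ρ : ι ≃ ι')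
    (h : ∀ a, dims a = dims' (ρ a)) :
    Nonempty (WedgeSpheres ι dims ≃ₜ WedgeSpheres ι' dims') := by
  obtain rfl : dims = fun a => dims' (ρ a) := funext h
  let e : (Σ a, sph (dims' (ρ a))) ≃ Σ b, sph (dims' b) :=
    Equiv.sigmaCongrLeft (β := fun b => sph (dims' b)) ρ
  have he : Continuous e := continuous_sigma fun a =>
    @continuous_sigmaMk _ (fun b => sph (dims' b)) _ (ρ a)
  have he' : Continuous e.symm := by
    refine continuous_sigma fun b => ?_
    obtain ⟨a, rfl⟩ := ρ.surjective b
    have : (fun x => e.symm ⟨ρ a, x⟩) = fun x => (⟨a, x⟩ : Σ a, sph (dims' (ρ a))) :=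
      funext fun x => e.symm_apply_apply ⟨a, x⟩
    rw [this]
    exact @continuous_sigmaMk _ (fun a => sph (dims' (ρ a))) _ _
  have hr : ∀ y : Σ b, sph (dims' b), y.2 = sphBase _ → (e.symm y).2 = sphBase _ := by
    rintro ⟨b, y⟩ hy
    obtain rfl : y = sphBase _ := hy
    obtain ⟨a, rfl⟩ := ρ.surjective b
    rw [show e.symm ⟨ρ a, sphBase _⟩ = ⟨a, sphBase _⟩ from e.symm_apply_apply ⟨a, _⟩]
  let f : WedgeSpheres ι (fun a => dims' (ρ a)) → WedgeSpheres ι' dims' :=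
    Quot.map e fun _ _ h => h
  let g : WedgeSpheres ι' dims' → WedgeSpheres ι (fun a => dims' (ρ a)) :=
    Quot.map e.symm fun _ _ h => ⟨hr _ h.1, hr _ h.2⟩
  refine ⟨⟨⟨f, g, ?_, ?_⟩, ?_, ?_⟩⟩
  · rintro ⟨x⟩
    exact congrArg (Quot.mk _) (e.symm_apply_apply x)
  · rintro ⟨x⟩
    exact congrArg (Quot.mk _) (e.apply_symm_apply x)
  · exact continuous_quot_lift _ (continuous_quot_mk.comp he)
  · exact continuous_quot_lift _ (continuous_quot_mk.comp he')

end Transport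

section Counting

open Tr

variable {m k : ℕ}

noncomputable instance Tr.fintypeIx {D : Type} : ∀ t : Tr D, Fintype t.ix
  | .leaf => inferInstanceAs (Fintype Unit)
  | .zero => inferInstanceAs (Fintype Empty)
  | .node _ l r =>
    have := fintypeIx l
    have := fintypeIx r
    inferInstanceAs (Fintype (l.ix ⊕ r.ix))

/-- Relabelled proper colorings. -/
abbrev Col (k : ℕ) (E : List (Fin m × Fin m)) (τ : Fin m → Fin m) : Type :=
  {f : Fin m → Fin k // ∀ e ∈ E, f (τ e.1) ≠ f (τ e.2)}

theorem update_ct (e : Fin m × Fin m) (τ : Fin m → Fin m) (f : Fin m → Fin k) (x : Fin m) :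
    Function.update f (τ e.2) (f (τ e.1)) (τ x) = f (ct τ e x) := by
  by_cases h : τ x = τ e.2 <;> simp [ct, sg, h]

theorem card_col_ct (E : List (Fin m × Fin m)) (τ : Fin m → Fin m) (e : Fin m × Fin m)
    (he : τ e.1 ≠ τ e.2) :
    Nat.card (Col k E (ct τ e)) =
      Nat.card {f : Col k E τ // f.1 (τ e.1) = f.1 (τ e.2)} * k := by
  classical
  have hct : ∀ x, ct τ e x ≠ τ e.2 := fun x => sg_ne he _
  let ρ : Col k E (ct τ e) ≃ {f : Col k E τ // f.1 (τ e.1) = f.1 (τ e.2)} × Fin k :=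
    { toFun := fun f => (⟨⟨Function.update f.1 (τ e.2) (f.1 (τ e.1)), fun e' h => by
        rw [update_ct, update_ct]
        exact f.2 e' h⟩, by simp [he]⟩, f.1 (τ e.2))
      invFun := fun g => ⟨Function.update g.1.1.1 (τ e.2) g.2, fun e' h => by
        rw [Function.update_of_ne (hct _), Function.update_of_ne (hct _), ← update_ct e τ g.1.1.1, ← update_ct e τ g.1.1.1,
          g.1.2, Function.update_eq_self]
        exact g.1.1.2 e' h⟩
      left_inv := fun f => by simp
      right_inv := fun g => by
        refine Prod.ext (Subtype.ext (Subtype.ext ?_)) (by simp)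
        simp [he, g.1.2] }
  rw [Nat.card_congr ρ, Nat.card_prod, Nat.card_fin]

theorem card_col_cons (E : List (Fin m × Fin m)) (τ : Fin m → Fin m) (e : Fin m × Fin m) :
    Nat.card (Col k E τ) = Nat.card {f : Col k E τ // f.1 (τ e.1) = f.1 (τ e.2)} +
      Nat.card (Col k (e :: E) τ) := by
  classical
  have h : Nat.card (Col k (e :: E) τ) =
      Nat.card {f : Col k E τ // ¬ f.1 (τ e.1) = f.1 (τ e.2)} :=
    Nat.card_congr
      { toFun := fun f => ⟨⟨f.1, fun e' h => f.2 e' (List.mem_cons_of_mem _ h)⟩,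
          f.2 e List.mem_cons_self⟩
        invFun := fun f => ⟨f.1.1, fun e' h => by
          rcases List.mem_cons.1 h with rfl | h
          · exact f.2
          · exact f.1.2 e' h⟩
        left_inv := fun _ => rfl
        right_inv := fun _ => rfl }
  rw [h, ← Nat.card_sum]
  exact (Nat.card_congr (Equiv.sumCompl _)).symm

theorem card_col (hk : k ≠ 0) (E : List (Fin m × Fin m)) (τ : Fin m → Fin m) :
    (Nat.card (Col k E τ) : ℚ) = k ^ m * ∑ a : (tree E τ).ix, (-(k : ℚ)⁻¹) ^ (tree E τ).ht a := by
  induction E generalizing τ with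
  | nil =>
    have h : Nat.card (Col k [] τ) = k ^ m := by
      rw [Nat.card_congr (Equiv.subtypeUnivEquiv fun f => by simp)]
      simp
    rw [h]
    change _ = (k : ℚ) ^ m * ∑ a : Unit, (-(k : ℚ)⁻¹) ^ 0
    simp
  | cons e E ih =>
    by_cases he : τ e.1 = τ e.2
    · rw [tree_cons_eq he]
      have h : IsEmpty (Col k (e :: E) τ) := ⟨fun f => f.2 e List.mem_cons_self (by rw [he])⟩
      rw [Nat.card_of_isEmpty]
      change _ = (k : ℚ) ^ m * ∑ a : Empty, _
      simp
    · rw [tree_cons_ne he]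
      have h1 : (Nat.card (Col k E τ) : ℚ) = _ := congrArg Nat.cast (card_col_cons (k := k) E τ e)
      have h2 : (Nat.card (Col k E (ct τ e)) : ℚ) = _ :=
        congrArg Nat.cast (card_col_ct (k := k) E τ e he)
      rw [ih] at h1 h2
      push_cast at h1 h2
      have hk' : (k : ℚ) ≠ 0 := by exact_mod_cast hk
      have h3 : (∑ a : (Tr.node e (tree E (ct τ e)) (tree E τ)).ix,
          (-(k : ℚ)⁻¹) ^ (Tr.node e (tree E (ct τ e)) (tree E τ)).ht a) =
          ∑ a, (-(k : ℚ)⁻¹) ^ ((tree E (ct τ e)).ht a + 1) +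
            ∑ a, (-(k : ℚ)⁻¹) ^ (tree E τ).ht a := Fintype.sum_sum_type _
      simp only [pow_succ _ (Tr.ht _ _), ← Finset.sum_mul] at h3
      rw [h3, mul_add, h1, ← mul_assoc, h2]
      field_simp
      ring

theorem coeff_chromatic {E : List (Fin m × Fin m)} {τ : Fin m → Fin m} {P : Polynomial ℤ}
    (hP : ∀ k : ℕ, P.eval (k : ℤ) = Nat.card (Col k E τ)) (s : ℕ) :
    (-1) ^ s * (Nat.card {a : (tree E τ).ix // (tree E τ).ht a = s} : ℤ) =
      if s ≤ m then P.coeff (m - s) else 0 := by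
  classical
  set t := tree E τ with ht
  let B := Finset.univ.sup t.ht + s
  have hB : ∀ a, t.ht a ≤ B := fun a => (Finset.le_sup (Finset.mem_univ a)).trans (Nat.le_add_right _ _)
  have key : P * Polynomial.X ^ B =
      ∑ a : t.ix, Polynomial.C ((-1) ^ t.ht a) * Polynomial.X ^ (m + B - t.ht a) := by
    refine Polynomial.eq_of_infinite_eval_eq _ _ (Set.Infinite.mono (s := Set.range fun k : ℕ =>
      ((k + 1 : ℕ) : ℤ)) ?_ (Set.infinite_range_of_injective fun a b h => by simpa using h))
    rintro _ ⟨k, rfl⟩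
    change Polynomial.eval _ _ = Polynomial.eval _ _
    simp only [Polynomial.eval_mul, Polynomial.eval_pow, Polynomial.eval_X, Polynomial.eval_finsetSum,
      Polynomial.eval_C]
    rw [hP]
    have h := card_col (Nat.succ_ne_zero k) E τ
    rw [← ht] at h
    have hk : ((k + 1 : ℕ) : ℚ) ≠ 0 := by exact_mod_cast Nat.succ_ne_zero k
    have : ((Nat.card (Col (k + 1) E τ) : ℤ) * ((k + 1 : ℕ) : ℤ) ^ B : ℚ) =
        ∑ a : t.ix, ((-1) ^ t.ht a * ((k + 1 : ℕ) : ℤ) ^ (m + B - t.ht a) : ℚ) := by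
      simp only [Int.cast_natCast]
      rw [h, mul_right_comm, ← pow_add, Finset.mul_sum]
      refine Finset.sum_congr rfl fun a _ => ?_
      obtain ⟨c, hc⟩ := Nat.exists_eq_add_of_le ((hB a).trans (Nat.le_add_left B m))
      rw [hc, Nat.add_sub_cancel_left, neg_pow, inv_pow, pow_add]
      field_simp
    exact_mod_cast this
  have hc := congrArg (fun p => p.coeff (m + B - s)) key
  have hs : s ≤ B := Nat.le_add_left _ _
  simp only [Polynomial.finsetSum_coeff, Polynomial.coeff_C_mul, Polynomial.coeff_X_pow] at hc
  rw [Polynomial.coeff_mul_X_pow'] at hc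
  have h1 : ∀ a, (m + B - s = m + B - t.ht a) ↔ t.ht a = s := fun a => by
    have := hB a
    omega
  have h2 : ∀ a, ((-1 : ℤ) ^ t.ht a * if m + B - s = m + B - t.ht a then 1 else 0) =
      if t.ht a = s then (-1) ^ s else 0 := fun a => by
    rw [if_congr (h1 a) rfl rfl]
    split_ifs with h
    · rw [h, mul_one]
    · rw [mul_zero]
  simp only [h2] at hc
  rw [Finset.sum_ite, Finset.sum_const_zero, add_zero, Finset.sum_const, nsmul_eq_mul] at hc
  rw [Nat.card_eq_fintype_card, Fintype.card_subtype, mul_comm, ← hc]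
  refine if_congr (by omega) ?_ rfl
  congr 1
  omega

theorem nonempty_ix_tree (E : List (Fin m × Fin m)) (τ : Fin m → Fin m)
    (h : ∀ e ∈ E, τ e.1 ≠ τ e.2) : Nonempty (tree E τ).ix := by
  induction E with
  | nil => exact ⟨()⟩
  | cons e E ih =>
    rw [tree_cons_ne (h e List.mem_cons_self)]
    obtain ⟨a⟩ := ih fun e he => h e (List.mem_cons_of_mem _ he)
    exact ⟨Sum.inr a⟩

theorem exists_ix_equiv (hm : 1 ≤ m) {E : List (Fin m × Fin m)} {τ : Fin m → Fin m}
    {P : Polynomial ℤ} (hP : ∀ k : ℕ, P.eval (k : ℤ) = Nat.card (Col k E τ)) :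
    ∃ ρ : (tree E τ).ix ≃ (i : Fin m) × Fin (((-1 : ℤ) ^ (m - (i.val + 1)) *
      P.coeff (i.val + 1)).toNat), ∀ a, (tree E τ).ht a = m - ((ρ a).1.val + 1) := by
  classical
  set t := tree E τ with ht
  have hcard : ∀ s, s < m →
      Nat.card {a : t.ix // t.ht a = s} = ((-1 : ℤ) ^ s * P.coeff (m - s)).toNat := by
    intro s hs
    have h := coeff_chromatic hP s
    rw [if_pos hs.le] at h
    rw [← h, ← mul_assoc, ← mul_pow]
    simp
    rfl
  have hlt : ∀ a, t.ht a < m := by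
    intro a
    by_contra! hle
    have h0 : P.coeff 0 = 0 := by
      have h := hP 0
      have : IsEmpty (Col 0 E τ) := ⟨fun f => (f.1 ⟨0, hm⟩).elim0⟩
      rw [Nat.card_of_isEmpty] at h
      rw [Polynomial.coeff_zero_eq_eval_zero]
      exact_mod_cast h
    have h := coeff_chromatic hP (t.ht a)
    have h' : (if t.ht a ≤ m then P.coeff (m - t.ht a) else 0) = 0 := by
      split_ifs with h2
      · rw [show m - t.ht a = 0 by omega, h0]
      · rfl
    rw [h'] at h
    have h3 : Nat.card {b : t.ix // t.ht b = t.ht a} = 0 := by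
      have := (mul_eq_zero.1 h).resolve_left (pow_ne_zero _ (by norm_num))
      exact_mod_cast this
    rw [Nat.card_eq_zero] at h3
    rcases h3 with h3 | h3
    · exact h3.false ⟨a, rfl⟩
    · exact h3.not_finite inferInstance
  let g : t.ix → Fin m := fun a => ⟨m - (t.ht a + 1), by have := hlt a; omega⟩
  have hg : ∀ a i, g a = i ↔ t.ht a = m - (i.val + 1) := fun a i => by
    rw [Fin.ext_iff]
    have := hlt a
    have := i.2
    simp only [g]
    omega
  have hfib : ∀ i : Fin m, Nonempty ({a // g a = i} ≃
      Fin (((-1 : ℤ) ^ (m - (i.val + 1)) * P.coeff (i.val + 1)).toNat)) := fun i => by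
    have h := hcard (m - (i.val + 1)) (by have := i.2; omega)
    rw [show m - (m - (i.val + 1)) = i.val + 1 by have := i.2; omega] at h
    have h' : Nat.card {a // g a = i} = Nat.card {a // t.ht a = m - (i.val + 1)} :=
      Nat.card_congr (Equiv.subtypeEquivRight fun a => hg a i)
    exact ⟨Finite.equivFinOfCardEq (h'.trans h)⟩
  exact ⟨(Equiv.sigmaFiberEquiv g).symm.trans (Equiv.sigmaCongrRight fun i => (hfib i).some),
    fun a => (hg a _).1 rfl⟩

end Counting

theorem stmt2 (m N : ℕ) (hm : 1 ≤ m) (hN : 2 ≤ N)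
    (G : SimpleGraph (Fin m))
    (P : Polynomial ℤ)
    (hP : ∀ k : ℕ, P.eval (k : ℤ) =
      Nat.card {f : Fin m → Fin k // ∀ i j, G.Adj i j → f i ≠ f j}) :
    Nonempty (ContinuousMap.HomotopyEquiv
      (Susp (chromConf N m G ⊕ PUnit))
      (WedgeSpheres
        ((i : Fin m) × Fin (((-1 : ℤ) ^ (m - (i.val + 1)) * P.coeff (i.val + 1)).toNat))
        (fun j => (m - (j.1.val + 1)) * (N - 1) + 1))) := by
  classical
  obtain ⟨n, rfl⟩ := Nat.exists_eq_add_of_le' (one_le_two.trans hN)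
  let E : List (Fin m × Fin m) := (Finset.univ.filter fun e : Fin m × Fin m => G.Adj e.1 e.2).toList
  have hE : ∀ e, e ∈ E ↔ G.Adj e.1 e.2 := fun e => by simp [E]
  have hpred : ∀ {Z : Type} (f : Fin m → Z),
      (∀ i j, G.Adj i j → f i ≠ f j) ↔ ∀ e ∈ E, f (id e.1) ≠ f (id e.2) := fun f =>
    ⟨fun h e he => h _ _ ((hE e).1 he), fun h i j hij => h (i, j) ((hE (i, j)).2 hij)⟩
  have hP' : ∀ k : ℕ, P.eval (k : ℤ) = Nat.card (Col k E id) := fun k => by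
    rw [hP, Nat.card_congr (Equiv.subtypeEquivRight fun f => hpred f)]
  obtain ⟨ρ, hρ⟩ := exists_ix_equiv hm hP'
  obtain ⟨a₀⟩ := nonempty_ix_tree E id fun e he => ((hE e).1 he).ne
  obtain ⟨e⟩ := nonempty_homotopyEquiv_wedge (dirM n E id) (tree E id) a₀ (Phi_bijective E id)
  obtain ⟨w⟩ := nonempty_wedge_homeomorph (fun a => (tree E id).ht a * n + 1)
    (fun j => (m - (j.1.val + 1)) * n + 1) ρ fun a => by rw [hρ]
  have key : ∀ p q : Amb m n → Prop, p = q → ∀ Z : Type, ∀ [TopologicalSpace Z],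
      Nonempty (ContinuousMap.HomotopyEquiv (Susp (Subtype q ⊕ PUnit.{1})) Z) →
      Nonempty (ContinuousMap.HomotopyEquiv (Susp (Subtype p ⊕ PUnit.{1})) Z) := by
    rintro p _ rfl Z _ h
    exact h
  exact key _ _ (funext fun x => propext (hpred x)) _ ⟨e.trans w.toHomotopyEquiv⟩
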